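/- Let T > 0 and n ≥ 1. Let (X_i(t))_{t∈[0,T]}, i = 1,…,n, be independent centered Gaussian processes with almost surely continuous sample paths such that E[X_i(t)X_i(s)] = 2^{−K_i}((t^{2H_i}+s^{2H_i})^{K_i} − |t−s|^{2K_iH_i}) (bifractional Brownian motion covariances) with parameters K_i ∈ (0,1], H_i ∈ (0,1) satisfying K_1H_1 = 1/2 and 1/2 < K_2H_2 ≤ ⋯ ≤ K_nH_n. Let λ_i > 0, and let g : [0,T] → ℝ be a bounded measurable function such that |g(T) − g(t)| ≤ M(T−t) for all t ∈ [ν, T], for some constants M and ν ∈ (0,T). Then lim_{u→∞} P(sup_{t∈[0,T]}(∑_{i=1}^n λ_i X_i(t) − g(t)) > u) / Ψ((u+g(T))/(∑_{i=1}^n λ_i² T^{2K_iH_i})^{1/2}) = 1 + λ_1² T / (2^{K_1}(∑_{i=2}^n λ_i² K_i H_i T^{2K_iH_i} + λ_1² T/2)). -/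

import Mathlib

open MeasureTheory ProbabilityTheory Filter Set
open scoped Classical

/-- The standard normal tail function `Ψ(x) = P(Z > x)`. -/
noncomputable def stdNormalTail (x : ℝ) : ℝ := ((gaussianReal 0 1) (Set.Ioi x)).toReal

/-- A centered Gaussian process on `[0,T]`: every finite linear combination of its
values is a centered Gaussian random variable. -/
def IsCenteredGaussianProcess {Ω : Type*} [MeasurableSpace Ω] (P : Measure Ω)
    (T : ℝ) (X : ℝ → Ω → ℝ) : Prop :=
  (∀ t ∈ Set.Icc (0:ℝ) T, Measurable (X t)) ∧
    ∀ (k : ℕ) (c : Fin k → ℝ) (t : Fin k → ℝ), (∀ j, t j ∈ Set.Icc (0:ℝ) T) →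
      ∃ v : NNReal, Measure.map (fun ω => ∑ j, c j * X (t j) ω) P = gaussianReal 0 v

section

open scoped NNReal ENNReal

/-! ### Gaussian random walks with negative drift -/

theorem lintegral_gaussianReal_exp_mul (m θ : ℝ) {q : ℝ≥0} (hq : q ≠ 0) {f : ℝ → ℝ≥0∞}
    (hf : Measurable f) :
    ∫⁻ a, f a * ENNReal.ofReal (Real.exp (θ * a)) ∂(gaussianReal m q) =
      ENNReal.ofReal (Real.exp (m * θ + q * θ ^ 2 / 2)) *
        ∫⁻ a, f a ∂(gaussianReal (m + θ * q) q) := by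
  rw [gaussianReal_of_var_ne_zero _ hq, gaussianReal_of_var_ne_zero _ hq,
    lintegral_withDensity_eq_lintegral_mul _ (measurable_gaussianPDF _ _) (by fun_prop),
    lintegral_withDensity_eq_lintegral_mul _ (measurable_gaussianPDF _ _) hf,
    ← lintegral_const_mul _ (by fun_prop)]
  refine lintegral_congr fun a => ?_
  simp only [Pi.mul_apply, gaussianPDF]
  rw [← mul_assoc, mul_right_comm, ← mul_assoc (ENNReal.ofReal _),
    ← ENNReal.ofReal_mul (gaussianPDFReal_nonneg _ _ _), ← ENNReal.ofReal_mul (by positivity)]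
  congr 2
  simp only [gaussianPDFReal]
  rw [mul_assoc, ← Real.exp_add, mul_left_comm, ← Real.exp_add]
  congr 2
  have : (q : ℝ) ≠ 0 := by exact_mod_cast hq
  field_simp
  ring

theorem gaussianReal_Ici_le (m a l : ℝ) (q : ℝ≥0) (hl : 0 ≤ l) :
    gaussianReal m q (Ici a) ≤ ENNReal.ofReal (Real.exp (-l * a + (m * l + q * l ^ 2 / 2))) := by
  have h := measure_ge_le_exp_mul_mgf (X := id) (μ := gaussianReal m q) (t := l) a hl
    (integrable_exp_mul_gaussianReal l)
  rw [mgf_id_gaussianReal] at h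
  simp only [← Real.exp_add] at h
  rw [← ofReal_measureReal]
  exact ENNReal.ofReal_le_ofReal h

/-- The increments `x` for which the walk `k ↦ x₀ + ⋯ + x_{k-1}`, `k ≤ N`, exceeds `y`. -/
def walkExceeds (N : ℕ) (y : ℝ) : Set (Fin N → ℝ) :=
  {x | ∃ k ≤ N, y < ∑ i : Fin N, if (i : ℕ) < k then x i else 0}

theorem isOpen_walkExceeds (N : ℕ) (y : ℝ) : IsOpen (walkExceeds N y) := by
  have : walkExceeds N y = ⋃ k ∈ Set.Iic N,
      {x | y < ∑ i : Fin N, if (i : ℕ) < k then x i else 0} := by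
    ext x; simp [walkExceeds]
  rw [this]
  refine isOpen_biUnion fun k _ => isOpen_lt continuous_const ?_
  refine continuous_finsetSum _ fun i _ => ?_
  split_ifs <;> fun_prop

theorem walkExceeds_eq_univ (N : ℕ) {y : ℝ} (hy : y < 0) : walkExceeds N y = univ := by
  ext x
  simp only [walkExceeds, mem_ofPred_eq, mem_univ, iff_true]
  exact ⟨0, Nat.zero_le _, by simpa using hy⟩

theorem walkExceeds_zero {y : ℝ} (hy : 0 ≤ y) : walkExceeds 0 y = ∅ := by
  ext x
  simp [walkExceeds, hy]

theorem mem_walkExceeds_succ (N : ℕ) {y : ℝ} (hy : 0 ≤ y) (x : Fin (N + 1) → ℝ) :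
    x ∈ walkExceeds (N + 1) y ↔ (fun i => x (Fin.succ i)) ∈ walkExceeds N (y - x 0) := by
  simp only [walkExceeds, mem_ofPred_eq, Fin.sum_univ_succ, Fin.val_zero, Fin.val_succ]
  constructor
  · rintro ⟨k, hk, h⟩
    rcases k with _ | k
    · simp at h; linarith
    · refine ⟨k, by omega, ?_⟩
      simp at h
      linarith
  · rintro ⟨k, hk, h⟩
    refine ⟨k + 1, by omega, ?_⟩
    simp
    linarith

/-- The probability that a Gaussian walk of `N` steps exceeds `y`. -/
noncomputable def walkProb (m : ℝ) (q : ℝ≥0) (N : ℕ) (y : ℝ) : ℝ≥0∞ :=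
  Measure.pi (fun _ : Fin N => gaussianReal m q) (walkExceeds N y)

theorem antitone_walkProb (m : ℝ) (q : ℝ≥0) (N : ℕ) : Antitone (walkProb m q N) := by
  intro y z h
  refine measure_mono ?_
  rintro x ⟨k, hk, hx⟩
  exact ⟨k, hk, h.trans_lt hx⟩

theorem measurable_walkProb (m : ℝ) (q : ℝ≥0) (N : ℕ) : Measurable (walkProb m q N) :=
  (antitone_walkProb m q N).measurable

theorem walkProb_of_neg (m : ℝ) (q : ℝ≥0) (N : ℕ) {y : ℝ} (hy : y < 0) :
    walkProb m q N y = 1 := by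
  rw [walkProb, walkExceeds_eq_univ N hy, measure_univ]

theorem walkProb_le_one (m : ℝ) (q : ℝ≥0) (N : ℕ) (y : ℝ) : walkProb m q N y ≤ 1 := prob_le_one

theorem walkProb_zero (m : ℝ) (q : ℝ≥0) {y : ℝ} (hy : 0 ≤ y) : walkProb m q 0 y = 0 := by
  rw [walkProb, walkExceeds_zero hy, measure_empty]

theorem walkProb_succ (m : ℝ) (q : ℝ≥0) (N : ℕ) {y : ℝ} (hy : 0 ≤ y) :
    walkProb m q (N + 1) y = ∫⁻ a, walkProb m q N (y - a) ∂(gaussianReal m q) := by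
  have hmp := measurePreserving_piFinSuccAbove (fun _ : Fin (N + 1) => gaussianReal m q) 0
  have hS : MeasurableSet {p : ℝ × (Fin N → ℝ) | p.2 ∈ walkExceeds N (y - p.1)} := by
    have : {p : ℝ × (Fin N → ℝ) | p.2 ∈ walkExceeds N (y - p.1)} = ⋃ k ∈ Set.Iic N,
      {p | y - p.1 < ∑ i : Fin N, if (i : ℕ) < k then p.2 i else 0} := by
      ext x; simp [walkExceeds]
    rw [this]
    refine MeasurableSet.biUnion (to_countable _) fun k _ => measurableSet_lt (by fun_prop) ?_
    refine Finset.measurable_fun_sum _ fun i _ => ?_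
    split_ifs <;> fun_prop
  have hpre : walkExceeds (N + 1) y = (MeasurableEquiv.piFinSuccAbove (fun _ : Fin (N + 1) => ℝ) 0)
      ⁻¹' {p : ℝ × (Fin N → ℝ) | p.2 ∈ walkExceeds N (y - p.1)} := by
    ext x
    rw [mem_walkExceeds_succ N hy]
    rfl
  rw [walkProb, hpre, hmp.measure_preimage hS.nullMeasurableSet, Measure.prod_apply hS]
  rfl

theorem walkProb_le (θ : ℝ) (hθ : 0 ≤ θ) (q : ℝ≥0) (N : ℕ) (y : ℝ) :
    walkProb (-(q * θ / 2)) q N y ≤ ENNReal.ofReal (Real.exp (-θ * y)) := by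
  induction N generalizing y with
  | zero =>
    rcases lt_or_ge y 0 with hy | hy
    · rw [walkProb_of_neg _ _ _ hy, ← ENNReal.ofReal_one]
      exact ENNReal.ofReal_le_ofReal (Real.one_le_exp (by nlinarith))
    · rw [walkProb_zero _ _ hy]; exact zero_le
  | succ N ih =>
    rcases lt_or_ge y 0 with hy | hy
    · rw [walkProb_of_neg _ _ _ hy, ← ENNReal.ofReal_one]
      exact ENNReal.ofReal_le_ofReal (Real.one_le_exp (by nlinarith))
    · rw [walkProb_succ _ _ _ hy]
      calc _ ≤ ∫⁻ a, ENNReal.ofReal (Real.exp (-θ * (y - a))) ∂(gaussianReal (-(q * θ / 2)) q) :=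
            lintegral_mono fun a => ih _
        _ = ENNReal.ofReal (∫ a, Real.exp (-θ * y) * Real.exp (θ * a)
              ∂(gaussianReal (-(q * θ / 2)) q)) := by
            rw [ofReal_integral_eq_lintegral_ofReal
              ((integrable_exp_mul_gaussianReal θ).const_mul _)
              (Eventually.of_forall fun a => by positivity)]
            refine lintegral_congr fun a => ?_
            rw [← Real.exp_add]; ring_nf
        _ = _ := by
            rw [integral_const_mul]
            have := congrFun (mgf_id_gaussianReal (μ := -(q * θ / 2)) (v := q)) θ
            simp only [mgf, id] at this
            rw [this, ← Real.exp_add]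
            ring_nf

theorem le_walkProb (θ : ℝ) (hθ : 0 ≤ θ) {q : ℝ≥0} (hq : q ≠ 0) (κ : ℝ) (N : ℕ) (y : ℝ)
    (hy : -κ ≤ y) :
    ENNReal.ofReal (Real.exp (-θ * (y + κ))) *
        gaussianReal (N * (q * θ / 2)) (N * q) (Ioi y) ≤
      walkProb (-(q * θ / 2)) q N y +
        ENNReal.ofReal (Real.exp (-θ * (y + κ))) *
          (N * gaussianReal (q * θ / 2) q (Ioi κ)) := by
  have hneg : ∀ (N : ℕ) (y : ℝ), -κ ≤ y → y < 0 → ENNReal.ofReal (Real.exp (-θ * (y + κ))) *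
        gaussianReal (N * (q * θ / 2)) (N * q) (Ioi y) ≤
      walkProb (-(q * θ / 2)) q N y +
        ENNReal.ofReal (Real.exp (-θ * (y + κ))) *
          (N * gaussianReal (q * θ / 2) q (Ioi κ)) := by
    intro N y hy hy0
    rw [walkProb_of_neg _ _ _ hy0]
    refine le_trans ?_ le_self_add
    calc _ ≤ (1 : ℝ≥0∞) * 1 := by
          gcongr
          · rw [← ENNReal.ofReal_one]
            exact ENNReal.ofReal_le_ofReal (Real.exp_le_one_iff.2 (by nlinarith))
          · exact prob_le_one
      _ = 1 := one_mul 1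
  induction N generalizing y with
  | zero =>
    rcases lt_or_ge y 0 with hy0 | hy0
    · exact hneg 0 y hy hy0
    · simp [gaussianReal_zero_var, Set.indicator, not_lt.2 hy0]
  | succ N ih =>
    rcases lt_or_ge y 0 with hy0 | hy0
    · exact hneg _ y hy hy0
    set b := gaussianReal (q * θ / 2) q (Ioi κ) with hb
    set e := fun y => ENNReal.ofReal (Real.exp (-θ * (y + κ))) with he
    have hconv : gaussianReal ((N + 1 : ℕ) * (q * θ / 2)) ((N + 1 : ℕ) * q) (Ioi y) =
        ∫⁻ a, gaussianReal (N * (q * θ / 2)) (N * q) (Ioi (y - a))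
          ∂(gaussianReal (q * θ / 2) q) := by
      have h1 : gaussianReal ((N + 1 : ℕ) * (q * θ / 2)) ((N + 1 : ℕ) * q) =
          gaussianReal (q * θ / 2) q ∗ gaussianReal (N * (q * θ / 2)) (N * q) := by
        rw [gaussianReal_conv_gaussianReal]
        congr 1 <;> push_cast <;> ring
      rw [h1, ← lintegral_indicator_one measurableSet_Ioi, Measure.lintegral_conv
        (measurable_one.indicator measurableSet_Ioi)]
      refine lintegral_congr fun a => ?_
      rw [← lintegral_indicator_one measurableSet_Ioi]
      refine lintegral_congr fun z => ?_
      simp [Set.indicator, sub_lt_iff_lt_add']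
    have hmeas : Measurable fun a =>
        gaussianReal (N * (q * θ / 2)) (N * q) (Ioi (y - a)) := by
      have : Antitone fun z => gaussianReal (N * (q * θ / 2)) (N * q) (Ioi z) :=
        fun z w h => measure_mono (Ioi_subset_Ioi h)
      exact this.measurable.comp (by fun_prop)
    have hsplit : ∫⁻ a, gaussianReal (N * (q * θ / 2)) (N * q) (Ioi (y - a))
          ∂(gaussianReal (q * θ / 2) q) ≤
        ∫⁻ a in Iic κ, gaussianReal (N * (q * θ / 2)) (N * q) (Ioi (y - a))
          ∂(gaussianReal (q * θ / 2) q) + b := by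
      rw [← lintegral_add_compl _ (measurableSet_Iic (a := κ)), compl_Iic]
      gcongr
      calc _ ≤ ∫⁻ a in Ioi κ, 1 ∂(gaussianReal (q * θ / 2) q) :=
            lintegral_mono fun a => prob_le_one
        _ = b := by simp [hb]
    have htilt : ∫⁻ a, ENNReal.ofReal (Real.exp (-θ * a)) * walkProb (-(q * θ / 2)) q N (y - a)
        ∂(gaussianReal (q * θ / 2) q) = walkProb (-(q * θ / 2)) q (N + 1) y := by
      rw [walkProb_succ _ _ _ hy0]
      have := lintegral_gaussianReal_exp_mul (q * θ / 2) (-θ) hq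
        (f := fun a => walkProb (-(q * θ / 2)) q N (y - a))
        ((measurable_walkProb _ _ _).comp (by fun_prop))
      rw [show (q : ℝ) * θ / 2 * -θ + q * (-θ) ^ 2 / 2 = 0 by ring, Real.exp_zero,
        ENNReal.ofReal_one, one_mul, show (q : ℝ) * θ / 2 + -θ * q = -(q * θ / 2) by ring] at this
      rw [← this]
      exact lintegral_congr fun a => mul_comm _ _
    have hmain : e y * ∫⁻ a in Iic κ, gaussianReal (N * (q * θ / 2)) (N * q) (Ioi (y - a))
          ∂(gaussianReal (q * θ / 2) q) ≤
        walkProb (-(q * θ / 2)) q (N + 1) y + e y * (N * b) := by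
      rw [← lintegral_const_mul _ hmeas, ← htilt]
      calc _ ≤ ∫⁻ a in Iic κ, (ENNReal.ofReal (Real.exp (-θ * a)) *
              walkProb (-(q * θ / 2)) q N (y - a) + e y * (N * b))
              ∂(gaussianReal (q * θ / 2) q) := by
            refine setLIntegral_mono' measurableSet_Iic fun a ha => ?_
            have h := ih (y - a) (by rw [mem_Iic] at ha; linarith)
            have hey : e y = ENNReal.ofReal (Real.exp (-θ * a)) * e (y - a) := by
              simp only [he]
              rw [← ENNReal.ofReal_mul (by positivity), ← Real.exp_add]
              ring_nf
            rw [hey, mul_assoc, mul_assoc, ← mul_add]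
            gcongr
        _ ≤ ∫⁻ a, (ENNReal.ofReal (Real.exp (-θ * a)) *
              walkProb (-(q * θ / 2)) q N (y - a) + e y * (N * b))
              ∂(gaussianReal (q * θ / 2) q) := setLIntegral_le_lintegral _ _
        _ = _ := by
            rw [lintegral_add_right _ measurable_const, lintegral_const, measure_univ, mul_one]
    calc _ = e y * ∫⁻ a, gaussianReal (N * (q * θ / 2)) (N * q) (Ioi (y - a))
          ∂(gaussianReal (q * θ / 2) q) := by rw [hconv]
      _ ≤ e y * (∫⁻ a in Iic κ, gaussianReal (N * (q * θ / 2)) (N * q) (Ioi (y - a))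
          ∂(gaussianReal (q * θ / 2) q) + b) := by gcongr
      _ ≤ walkProb (-(q * θ / 2)) q (N + 1) y + e y * (N * b) + e y * b := by
          rw [mul_add]; gcongr
      _ = _ := by push_cast; ring

theorem tendsto_pow_four_mul_exp_neg_mul (κ c : ℝ) (hκ : 0 < κ) :
    Tendsto (fun k : ℕ => (k : ℝ) ^ 4 * Real.exp (-k * κ + c)) atTop (nhds 0) := by
  have h := (Real.tendsto_pow_mul_exp_neg_atTop_nhds_zero 4).comp
    (tendsto_natCast_atTop_atTop.atTop_mul_const hκ)
  have h2 := h.const_mul (Real.exp c / κ ^ 4)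
  rw [mul_zero] at h2
  refine h2.congr fun k => ?_
  simp only [Function.comp]
  rw [neg_mul, Real.exp_add]
  field_simp

theorem le_liminf_walkProb (θ : ℝ) (hθ : 0 < θ) {r : ℝ≥0} (hr : r ≠ 0) (y : ℝ) (hy : 0 ≤ y) :
    ENNReal.ofReal (Real.exp (-θ * y)) ≤
      liminf (fun k : ℕ => walkProb (-((r / (k + 1) ^ 2 : ℝ≥0) * θ / 2)) (r / (k + 1) ^ 2)
        ((k + 1) ^ 4) y) atTop := by
  have key : ∀ κ > 0, ENNReal.ofReal (Real.exp (-θ * (y + κ))) ≤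
      liminf (fun k : ℕ => walkProb (-((r / (k + 1) ^ 2 : ℝ≥0) * θ / 2)) (r / (k + 1) ^ 2)
        ((k + 1) ^ 4) y) atTop := by
    intro κ hκ
    set e := ENNReal.ofReal (Real.exp (-θ * (y + κ))) with he
    let a : ℕ → ℝ := fun k => Real.exp (θ / 2 * y - ((k : ℝ) + 1) ^ 2 * r * (θ ^ 2 / 8))
    let b : ℕ → ℝ := fun k => ((k + 1 : ℕ) : ℝ) ^ 4 *
      Real.exp (-((k + 1 : ℕ) : ℝ) * κ + (r * θ / 2 + r / 2))
    have ha : Tendsto a atTop (nhds 0) := by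
      refine Real.tendsto_exp_atBot.comp ?_
      refine tendsto_atBot_add_const_left _ _ ?_
      rw [tendsto_neg_atBot_iff]
      have hr' : (0 : ℝ) < r := by positivity
      refine Tendsto.atTop_mul_const (by positivity) ?_
      refine Tendsto.atTop_mul_const (by positivity) ?_
      exact (tendsto_pow_atTop (by norm_num)).comp
        (tendsto_atTop_add_const_right _ _ tendsto_natCast_atTop_atTop)
    have hb : Tendsto b atTop (nhds 0) :=
      (tendsto_pow_four_mul_exp_neg_mul κ _ hκ).comp (tendsto_add_atTop_nat 1)
    have hbound : ∀ k : ℕ, e * (1 - ENNReal.ofReal (a k)) - e * ENNReal.ofReal (b k) ≤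
        walkProb (-((r / (k + 1) ^ 2 : ℝ≥0) * θ / 2)) (r / (k + 1) ^ 2) ((k + 1) ^ 4) y := by
      intro k
      have hk0 : ((k : ℝ) + 1) ≠ 0 := by positivity
      have h := le_walkProb θ hθ.le (q := r / (k + 1) ^ 2) (by positivity) κ ((k + 1) ^ 4) y
        (by linarith)
      rw [tsub_le_iff_right]
      refine le_trans ?_ (h.trans ?_)
      · gcongr
        rw [tsub_le_iff_right]
        set G := gaussianReal (((k + 1) ^ 4 : ℕ) * ((r / (k + 1) ^ 2 : ℝ≥0) * θ / 2))
          (((k + 1) ^ 4 : ℕ) * (r / (k + 1) ^ 2)) with hG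
        have hIic : G (Iic y) ≤ ENNReal.ofReal (a k) := by
          have h1 := gaussianReal_Ici_le (-(((k + 1) ^ 4 : ℕ) * ((r / (k + 1) ^ 2 : ℝ≥0) * θ / 2)))
            (-y) (θ / 2) (((k + 1) ^ 4 : ℕ) * (r / (k + 1) ^ 2)) (by positivity)
          rw [← gaussianReal_map_neg, Measure.map_apply (by fun_prop) measurableSet_Ici] at h1
          have : (fun x : ℝ => -x) ⁻¹' Ici (-y) = Iic y := by ext x; simp
          rw [this] at h1
          refine h1.trans (ENNReal.ofReal_le_ofReal (Real.exp_le_exp.2 (le_of_eq ?_)))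
          push_cast
          field_simp
          ring
        calc (1 : ℝ≥0∞) = G univ := measure_univ.symm
          _ = G (Ioi y ∪ Iic y) := by rw [union_comm, Iic_union_Ioi]
          _ ≤ G (Ioi y) + G (Iic y) := measure_union_le _ _
          _ ≤ _ := by gcongr
      · gcongr
        have h1 := (measure_mono (Ioi_subset_Ici_self (a := κ))).trans
          (gaussianReal_Ici_le ((r / (k + 1) ^ 2 : ℝ≥0) * θ / 2) κ (k + 1)
            (r / (k + 1) ^ 2) (by positivity))
        calc _ ≤ (((k + 1) ^ 4 : ℕ) : ℝ≥0∞) * ENNReal.ofReal _ := mul_le_mul_right h1 _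
          _ ≤ ENNReal.ofReal (b k) := by
            rw [← ENNReal.ofReal_natCast, ← ENNReal.ofReal_mul (by positivity)]
            refine ENNReal.ofReal_le_ofReal ?_
            simp only [b]
            push_cast
            gcongr _ * Real.exp ?_
            have hk1 : (1 : ℝ) ≤ k + 1 := by linarith [(Nat.cast_nonneg k : (0 : ℝ) ≤ k)]
            have hr0 : (0 : ℝ) ≤ r := r.2
            have e1 : (r : ℝ) / (k + 1) ^ 2 * θ / 2 * (k + 1) ≤ r * θ / 2 := by
              have : (r : ℝ) / (k + 1) ^ 2 * θ / 2 * (k + 1) = r * θ / 2 / (k + 1) := by field_simp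
              rw [this]
              exact div_le_self (by positivity) hk1
            have e2 : (r : ℝ) / (k + 1) ^ 2 * (k + 1) ^ 2 / 2 = r / 2 := by field_simp
            linarith
    have hlim : Tendsto (fun k => e * (1 - ENNReal.ofReal (a k)) - e * ENNReal.ofReal (b k)) atTop
        (nhds e) := by
      have ha' := ENNReal.tendsto_ofReal ha
      have hb' := ENNReal.tendsto_ofReal hb
      rw [ENNReal.ofReal_zero] at ha' hb'
      have h1 : Tendsto (fun k => 1 - ENNReal.ofReal (a k)) atTop (nhds (1 - 0)) :=
        ENNReal.Tendsto.sub tendsto_const_nhds ha' (by simp)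
      have h2 := ENNReal.Tendsto.const_mul (a := e) h1 (Or.inr (by simp [he]))
      have h3 := ENNReal.Tendsto.const_mul (a := e) hb' (Or.inr (by simp [he]))
      have h4 := ENNReal.Tendsto.sub h2 h3 (by simp [he])
      simpa using h4
    calc e = liminf (fun k => e * (1 - ENNReal.ofReal (a k)) - e * ENNReal.ofReal (b k)) atTop :=
          hlim.liminf_eq.symm
      _ ≤ _ := liminf_le_liminf (Eventually.of_forall hbound)
  have hcont : Tendsto (fun κ : ℝ => ENNReal.ofReal (Real.exp (-θ * (y + κ)))) (nhdsWithin 0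
      (Ioi 0))
      (nhds (ENNReal.ofReal (Real.exp (-θ * y)))) := by
    have : Continuous fun κ : ℝ => ENNReal.ofReal (Real.exp (-θ * (y + κ))) :=
      ENNReal.continuous_ofReal.comp (by fun_prop)
    have := (this.tendsto 0).mono_left (nhdsWithin_le_nhds (s := Ioi 0))
    simpa using this
  exact le_of_tendsto hcont (eventually_mem_nhdsWithin.mono fun κ hκ => key κ hκ)

theorem lintegral_exp_Iic (c : ℝ) :
    ∫⁻ y in Iic c, ENNReal.ofReal (Real.exp y) = ENNReal.ofReal (Real.exp c) := by
  rw [← ofReal_integral_eq_lintegral_ofReal (integrableOn_exp_Iic c)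
    (Eventually.of_forall fun y => (Real.exp_pos y).le), integral_exp_Iic]

theorem lintegral_exp_mul_Ioi {a : ℝ} (ha : a < 0) :
    ∫⁻ y in Ioi 0, ENNReal.ofReal (Real.exp (a * y)) = ENNReal.ofReal (-a⁻¹) := by
  rw [← ofReal_integral_eq_lintegral_ofReal (integrableOn_exp_mul_Ioi ha 0)
    (Eventually.of_forall fun y => (Real.exp_pos _).le), integral_exp_mul_Ioi ha]
  simp [neg_div]

theorem lintegral_exp_mul_walkProb_le (θ : ℝ) (hθ : 1 < θ) (q : ℝ≥0) (N : ℕ) (η : ℝ) :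
    ∫⁻ y, ENNReal.ofReal (Real.exp y) * walkProb (-(q * θ / 2)) q N (y - η) ≤
      ENNReal.ofReal (Real.exp η * (1 + 1 / (θ - 1))) := by
  have h1 := lintegral_sub_right_eq_self (μ := volume) (fun y => ENNReal.ofReal (Real.exp (y + η)) *
    walkProb (-(q * θ / 2)) q N y) η
  simp only [sub_add_cancel] at h1
  rw [h1, ← lintegral_add_compl _ (measurableSet_Iic (a := (0 : ℝ))), compl_Iic, mul_add,
    ENNReal.ofReal_add (by positivity) (by have := sub_pos.2 hθ; positivity)]
  have hm : Measurable fun y : ℝ => ENNReal.ofReal (Real.exp y) := by fun_prop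
  gcongr
  · calc _ ≤ ∫⁻ y in Iic 0, ENNReal.ofReal (Real.exp η) * ENNReal.ofReal (Real.exp y) := by
          refine lintegral_mono fun y => ?_
          rw [← ENNReal.ofReal_mul (by positivity), ← Real.exp_add, add_comm η]
          exact mul_le_of_le_one_right' (walkProb_le_one _ _ _ _)
      _ = _ := by
          rw [lintegral_const_mul _ hm, lintegral_exp_Iic]; simp
  · calc _ ≤ ∫⁻ y in Ioi 0, ENNReal.ofReal (Real.exp η) *
            ENNReal.ofReal (Real.exp ((1 - θ) * y)) := by
          refine lintegral_mono fun y => ?_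
          calc _ ≤ ENNReal.ofReal (Real.exp (y + η)) * ENNReal.ofReal (Real.exp (-θ * y)) := by
                gcongr; exact walkProb_le θ (by linarith) q N y
            _ = _ := by
                rw [← ENNReal.ofReal_mul (by positivity), ← ENNReal.ofReal_mul (by positivity),
                  ← Real.exp_add, ← Real.exp_add]
                ring_nf
      _ = _ := by
          rw [lintegral_const_mul _ (by fun_prop), lintegral_exp_mul_Ioi (by linarith),
            ← ENNReal.ofReal_mul (by positivity)]
          congr 2
          rw [one_div, ← inv_neg, neg_sub]

theorem le_liminf_lintegral_exp_mul_walkProb (θ : ℝ) (hθ : 1 < θ) {r : ℝ≥0} (hr : r ≠ 0) :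
    ENNReal.ofReal (1 + 1 / (θ - 1)) ≤ liminf (fun k : ℕ => ∫⁻ y, ENNReal.ofReal (Real.exp y) *
      walkProb (-((r / (k + 1) ^ 2 : ℝ≥0) * θ / 2)) (r / (k + 1) ^ 2) ((k + 1) ^ 4) y) atTop := by
  refine le_trans ?_ (lintegral_liminf_le fun k => (by fun_prop : Measurable fun y : ℝ =>
    ENNReal.ofReal (Real.exp y)).mul (measurable_walkProb _ _ _))
  rw [← lintegral_add_compl _ (measurableSet_Iio (a := (0 : ℝ))), compl_Iio,
    ENNReal.ofReal_add (by positivity) (by have := sub_pos.2 hθ; positivity)]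
  gcongr
  · have := lintegral_exp_Iic 0
    rw [Real.exp_zero, setLIntegral_congr Iio_ae_eq_Iic.symm] at this
    rw [← this]
    refine setLIntegral_mono' measurableSet_Iio fun y hy => ?_
    simp [walkProb_of_neg _ _ _ (mem_Iio.1 hy)]
  · have := lintegral_exp_mul_Ioi (a := 1 - θ) (by linarith)
    rw [← inv_neg, neg_sub, ← one_div, setLIntegral_congr Ioi_ae_eq_Ici] at this
    rw [← this]
    refine setLIntegral_mono' measurableSet_Ici fun y hy => ?_
    rw [ENNReal.liminf_const_mul_of_ne_top ENNReal.ofReal_ne_top]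
    rw [show (1 - θ) * y = y + -θ * y by ring, Real.exp_add, ENNReal.ofReal_mul (by positivity)]
    gcongr
    exact le_liminf_walkProb θ (by linarith) hr y hy

/-! ### Centered Gaussian variables and regression on one coordinate -/

/-- `Y` is a centered Gaussian random variable of variance `s`. -/
def IsCenteredGaussian {Ω : Type*} [MeasurableSpace Ω] (P : Measure Ω) (Y : Ω → ℝ) (s : ℝ) : Prop :=
  0 ≤ s ∧ P.map Y = gaussianReal 0 s.toNNReal

section Regression

variable {Ω : Type*} [MeasurableSpace Ω] {P : Measure Ω}

theorem IsCenteredGaussian.aemeasurable {Y : Ω → ℝ} {s : ℝ} (h : IsCenteredGaussian P Y s) :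
    AEMeasurable Y P := by
  refine AEMeasurable.of_map_ne_zero ?_
  rw [h.2]
  exact IsProbabilityMeasure.ne_zero _

theorem IsCenteredGaussian.integral_cexp {Y : Ω → ℝ} {s : ℝ} (h : IsCenteredGaussian P Y s) :
    ∫ ω, Complex.exp (Y ω * Complex.I) ∂P = Complex.exp (-(s / 2 : ℝ)) := by
  have h1 := charFun_gaussianReal (μ := 0) (v := s.toNNReal) 1
  rw [← h.2, charFun_apply_real, integral_map h.aemeasurable (by fun_prop)] at h1
  have h3 : ((s.toNNReal : ℝ≥0) : ℂ) = (s : ℂ) := by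
    rw [Real.coe_toNNReal _ h.1]
  simp only [h3] at h1
  simp only [Complex.ofReal_one, one_mul] at h1
  rw [h1]
  push_cast
  ring_nf

theorem IsCenteredGaussian.measure_le {Y : Ω → ℝ} {s : ℝ} (h : IsCenteredGaussian P Y s) (a : ℝ)
    {l : ℝ} (hl : 0 ≤ l) :
    P {ω | a ≤ Y ω} ≤ ENNReal.ofReal (Real.exp (-l * a + s * l ^ 2 / 2)) := by
  have h1 := gaussianReal_Ici_le 0 a l s.toNNReal hl
  rw [← h.2, Measure.map_apply_of_aemeasurable h.aemeasurable measurableSet_Ici,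
    Real.coe_toNNReal _ h.1] at h1
  rw [zero_mul, zero_add] at h1
  exact h1

/-- The residuals of the regression of `I` on `B`, where `B` has variance `V` and `b i` is the
covariance of `I i` and `B`. -/
noncomputable def regressionResidual {N : ℕ} (V : ℝ) (b : Fin N → ℝ) (B : Ω → ℝ)
    (I : Fin N → Ω → ℝ) (ω : Ω) :
    EuclideanSpace ℝ (Fin N) :=
  WithLp.toLp 2 fun i => I i ω - b i / V * B ω

/-- `B` and `I` are jointly centered Gaussian, with variance `V` of `B`, covariances `b` between
`I` and `B`, and covariance matrix `G` of `I`. -/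
structure IsJointGaussian {N : ℕ} (P : Measure Ω) (B : Ω → ℝ) (I : Fin N → Ω → ℝ) (V : ℝ)
    (b : Fin N → ℝ) (G : Fin N → Fin N → ℝ) : Prop where
  measurable_fst : Measurable B
  measurable_snd : ∀ i, Measurable (I i)
  law : ∀ (a : ℝ) (c : Fin N → ℝ), IsCenteredGaussian P (fun ω => a * B ω + ∑ i, c i * I i ω)
    (a ^ 2 * V + 2 * a * ∑ i, c i * b i + ∑ i, ∑ l, c i * c l * G i l)

variable {N : ℕ} {B : Ω → ℝ} {I : Fin N → Ω → ℝ} {V : ℝ} {b : Fin N → ℝ} {G : Fin N → Fin N → ℝ}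

theorem IsJointGaussian.measurable_regressionResidual (h : IsJointGaussian P B I V b G) :
    Measurable (regressionResidual V b B I) := by
  have h1 := h.measurable_fst
  have h2 := h.measurable_snd
  unfold regressionResidual
  exact (WithLp.measurable_toLp 2 _).comp (measurable_pi_lambda _ fun i => by fun_prop)

theorem IsJointGaussian.law_regressionResidual (h : IsJointGaussian P B I V b G) (hV : 0 < V)
    (a : ℝ) (c : Fin N → ℝ) :
    IsCenteredGaussian P (fun ω => a * B ω + ∑ i, c i * (regressionResidual V b B I ω) i)
      (a ^ 2 * V + (∑ i, ∑ l, c i * c l * G i l - (∑ i, c i * b i) ^ 2 / V)) := by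
  have h1 := h.law (a - (∑ i, c i * b i) / V) c
  convert h1 using 1
  · ext ω
    simp only [regressionResidual, mul_sub, Finset.sum_sub_distrib, sub_mul]
    have : ∑ i, c i * (b i / V * B ω) = (∑ i, c i * b i) / V * B ω := by
      rw [Finset.sum_div, Finset.sum_mul]
      exact Finset.sum_congr rfl fun i _ => by ring
    rw [this]
    ring
  · field_simp
    ring

theorem IsJointGaussian.charFun_regressionResidual (h : IsJointGaussian P B I V b G) (hV : 0 < V)
    (c : EuclideanSpace ℝ (Fin N)) :
    charFun (P.map (regressionResidual V b B I)) c =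
      Complex.exp (-((∑ i, ∑ l, c i * c l * G i l - (∑ i, c i * b i) ^ 2 / V) / 2 : ℝ)) := by
  have h1 := (h.law_regressionResidual hV 0 c).integral_cexp
  rw [charFun_apply, integral_map h.measurable_regressionResidual.aemeasurable (by fun_prop)]
  simp only [zero_mul, zero_add, ne_eq, OfNat.ofNat_ne_zero, not_false_eq_true, zero_pow] at h1
  rw [← h1]
  simp [PiLp.inner_apply]

theorem IsJointGaussian.map_prod [IsProbabilityMeasure P] (h : IsJointGaussian P B I V b G)
    (hV : 0 < V) :
    P.map (fun ω => (B ω, regressionResidual V b B I ω)) =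
      (gaussianReal 0 V.toNNReal).prod (P.map (regressionResidual V b B I)) := by
  have hm := h.measurable_fst.prodMk h.measurable_regressionResidual
  have := Measure.isProbabilityMeasure_map (μ := P) h.measurable_regressionResidual.aemeasurable
  have := Measure.isProbabilityMeasure_map (μ := P) hm.aemeasurable
  rw [← charFun_eq_prod_iff]
  intro t
  rw [h.charFun_regressionResidual hV, charFun_gaussianReal, charFun_apply,
    integral_map (by fun_prop) (by fun_prop), integral_map hm.aemeasurable (by fun_prop)]
  have h1 := (h.law_regressionResidual hV t.fst t.snd).integral_cexp
  simp only [WithLp.prod_inner_apply, PiLp.inner_apply]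
  refine (Eq.trans ?_ h1).trans ?_
  · refine integral_congr_ae (Eventually.of_forall fun ω => ?_)
    simp [mul_comm]
  · rw [← Complex.exp_add]
    congr 1
    have h3 : ((V.toNNReal : ℝ≥0) : ℂ) = (V : ℂ) := by rw [Real.coe_toNNReal _ hV.le]
    simp only [h3]
    push_cast
    ring!

end Regression

/-- The leading order of the tail at `v` of a centered Gaussian variable of variance `V`. -/
noncomputable def tailNorm (V v : ℝ) : ℝ :=
  Real.sqrt V / (v * Real.sqrt (2 * Real.pi)) * Real.exp (-(v ^ 2 / (2 * V)))

theorem tailNorm_pos {V v : ℝ} (hV : 0 < V) (hv : 0 < v) : 0 < tailNorm V v := by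
  unfold tailNorm; positivity

/-- The limiting exponential density with its Gaussian correction. -/
noncomputable def tailDensity (V v y : ℝ) : ℝ≥0∞ :=
  ENNReal.ofReal (Real.exp (y - y ^ 2 * V / (2 * v ^ 2)))

theorem measurable_tailDensity (V v : ℝ) : Measurable (tailDensity V v) := by
  unfold tailDensity; fun_prop

theorem map_gaussianReal_rescale {V v : ℝ} (hV : 0 < V) (hv : 0 < v) :
    (gaussianReal 0 V.toNNReal).map (fun x => v * (v - x) / V) =
      volume.withDensity fun y => ENNReal.ofReal (tailNorm V v) * tailDensity V v y := by
  have h1 : (fun x : ℝ => v * (v - x) / V) = fun x => (v / V) * (v - x) := by ext; ring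
  have h2 : (fun x : ℝ => v / V * (v - x)) = (fun x => v / V * x) ∘ fun x => v - x := rfl
  rw [h1, h2, ← Measure.map_map (by fun_prop) (by fun_prop), gaussianReal_map_const_sub,
    gaussianReal_map_const_mul]
  have hVn : (V.toNNReal : ℝ) = V := Real.coe_toNNReal _ hV.le
  rw [gaussianReal_of_var_ne_zero]
  · congr 1
    ext y
    rw [gaussianPDF, tailDensity, ← ENNReal.ofReal_mul (tailNorm_pos hV hv).le]
    congr 1
    simp only [gaussianPDFReal, tailNorm, NNReal.coe_mul, NNReal.coe_mk, hVn, sub_zero]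
    rw [mul_assoc (Real.sqrt V / _), ← Real.exp_add]
    have e1 : 2 * Real.pi * ((v / V) ^ 2 * V) = (v / Real.sqrt V) ^ 2 * (2 * Real.pi) := by
      rw [div_pow, div_pow, Real.sq_sqrt hV.le]; field_simp
    rw [e1, Real.sqrt_mul (by positivity), Real.sqrt_sq (by positivity)]
    congr 1
    · have := Real.sqrt_ne_zero'.2 hV
      field_simp
    · congr 1
      field_simp
      ring
  · intro h
    have := congrArg NNReal.toReal h
    simp [hVn] at this
    rcases this with (h | h) | h <;> linarith

theorem IsJointGaussian.measure_eq {Ω : Type*} [MeasurableSpace Ω] {P : Measure Ω}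
    [IsProbabilityMeasure P] {N : ℕ} {B : Ω → ℝ} {I : Fin N → Ω → ℝ} {V : ℝ} {b : Fin N → ℝ}
    {G : Fin N → Fin N → ℝ} (h : IsJointGaussian P B I V b G) (hV : 0 < V) {v : ℝ} (hv : 0 < v)
    {S : Set (ℝ × EuclideanSpace ℝ (Fin N))} (hS : MeasurableSet S) :
    P {ω | (v * (v - B ω) / V, regressionResidual V b B I ω) ∈ S} =
      ENNReal.ofReal (tailNorm V v) * ∫⁻ y, tailDensity V v y *
        P.map (regressionResidual V b B I) {x | (y, x) ∈ S} := by
  have hm := h.measurable_fst.prodMk h.measurable_regressionResidual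
  have := Measure.isProbabilityMeasure_map (μ := P) h.measurable_regressionResidual.aemeasurable
  set f : ℝ × EuclideanSpace ℝ (Fin N) → ℝ × EuclideanSpace ℝ (Fin N) :=
    Prod.map (fun x => v * (v - x) / V) id with hf
  have hfm : Measurable f := Measurable.prodMap (by fun_prop) measurable_id
  have h1 : P {ω | (v * (v - B ω) / V, regressionResidual V b B I ω) ∈ S} =
      ((P.map fun ω => (B ω, regressionResidual V b B I ω)).map f) S := by
    rw [Measure.map_apply hfm hS, Measure.map_apply hm (hfm hS)]
    rfl
  rw [h1, h.map_prod hV, hf, ← Measure.map_prod_map _ _ (by fun_prop) measurable_id, Measure.map_id,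
    map_gaussianReal_rescale hV hv, Measure.prod_apply hS,
    lintegral_withDensity_eq_lintegral_mul _ ((measurable_tailDensity V v).const_mul _)
      (measurable_measure_prodMk_left hS), ← lintegral_const_mul]
  · refine lintegral_congr fun y => ?_
    simp only [Pi.mul_apply, mul_assoc]
    rfl
  · exact (measurable_tailDensity V v).mul (measurable_measure_prodMk_left hS)

/-! ### The first crossing of a finite grid near the right end point -/

section Grid

variable {Ω : Type*} [MeasurableSpace Ω] {P : Measure Ω} {N : ℕ}

/-- Conditional mean of the rescaled steps given that the rescaled overshoot is `-y`. -/
noncomputable def stepMean (V v a : ℝ) (b : Fin N → ℝ) (y : ℝ) (i : Fin N) : ℝ :=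
  b i * v ^ 2 / V ^ 2 - b i * y / V + v * a / V

/-- Rescaled steps given that the rescaled overshoot is `-y`. -/
noncomputable def rescaledSteps (V v a : ℝ) (b : Fin N → ℝ) (y : ℝ)
    (x : EuclideanSpace ℝ (Fin N)) : EuclideanSpace ℝ (Fin N) :=
  WithLp.toLp 2 fun i => v / V * x i + stepMean V v a b y i

theorem continuous_rescaledSteps (V v a : ℝ) (b : Fin N → ℝ) :
    Continuous fun p : ℝ × EuclideanSpace ℝ (Fin N) => rescaledSteps V v a b p.1 p.2 := by
  unfold rescaledSteps stepMean
  fun_prop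

/-- The event that one of the points of the grid exceeds the level `v - ε / v`. -/
def gridExceeds (B : Ω → ℝ) (I : Fin N → Ω → ℝ) (a v ε : ℝ) : Set Ω :=
  {ω | ∃ k ≤ N, v - ε / v < B ω + ∑ i : Fin N, if (i : ℕ) < k then I i ω + a else 0}

theorem gridExceeds_eq (B : Ω → ℝ) (I : Fin N → Ω → ℝ) (b : Fin N → ℝ) (a ε : ℝ) {V v : ℝ}
    (hV : 0 < V) (hv : 0 < v) :
    gridExceeds B I a v ε = {ω | (v * (v - B ω) / V, regressionResidual V b B I ω) ∈
      {p : ℝ × EuclideanSpace ℝ (Fin N) |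
        (rescaledSteps V v a b p.1 p.2).ofLp ∈ walkExceeds N (p.1 - ε / V)}} := by
  ext ω
  simp only [gridExceeds, walkExceeds, mem_ofPred_eq]
  refine exists_congr fun k => and_congr_right fun _ => ?_
  have h1 : ∀ i, (rescaledSteps V v a b (v * (v - B ω) / V) (regressionResidual V b B I ω)) i =
      v / V * (I i ω + a) := by
    intro i
    simp only [rescaledSteps, regressionResidual, stepMean]
    field_simp
    ring
  simp only [h1]
  have h2 : (∑ i : Fin N, if (i : ℕ) < k then v / V * (I i ω + a) else 0) =
      v / V * ∑ i : Fin N, if (i : ℕ) < k then I i ω + a else 0 := by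
    rw [Finset.mul_sum]
    exact Finset.sum_congr rfl fun i _ => by split_ifs <;> simp
  rw [h2]
  set s := ∑ i : Fin N, if (i : ℕ) < k then I i ω + a else 0
  have h3 : v * (v - B ω) / V - ε / V = v / V * (v - B ω - ε / v) := by field_simp
  rw [h3, mul_lt_mul_iff_right₀ (by positivity)]
  constructor <;> intro h <;> linarith

theorem measure_gridExceeds [IsProbabilityMeasure P] {B : Ω → ℝ} {I : Fin N → Ω → ℝ} {V : ℝ}
    {b : Fin N → ℝ} {G : Fin N → Fin N → ℝ} (h : IsJointGaussian P B I V b G) (hV : 0 < V)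
    (a ε : ℝ) {v : ℝ} (hv : 0 < v) :
    P (gridExceeds B I a v ε) = ENNReal.ofReal (tailNorm V v) * ∫⁻ y, tailDensity V v y *
      P {ω | (rescaledSteps V v a b y (regressionResidual V b B I ω)).ofLp ∈
        walkExceeds N (y - ε / V)} ∧
    Measurable fun y => P {ω | (rescaledSteps V v a b y (regressionResidual V b B I ω)).ofLp ∈
        walkExceeds N (y - ε / V)} := by
  have hS : MeasurableSet {p : ℝ × EuclideanSpace ℝ (Fin N) |
        (rescaledSteps V v a b p.1 p.2).ofLp ∈ walkExceeds N (p.1 - ε / V)} := by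
    refine IsOpen.measurableSet ?_
    have : {p : ℝ × EuclideanSpace ℝ (Fin N) |
        (rescaledSteps V v a b p.1 p.2).ofLp ∈ walkExceeds N (p.1 - ε / V)} =
      ⋃ k ∈ Set.Iic N, {p | p.1 - ε / V <
        ∑ i : Fin N, if (i : ℕ) < k then (rescaledSteps V v a b p.1 p.2) i else 0} := by
      ext p; simp [walkExceeds]
    rw [this]
    refine isOpen_biUnion fun k _ => isOpen_lt (by fun_prop) ?_
    refine continuous_finsetSum _ fun i _ => ?_
    split_ifs
    · simp only [rescaledSteps, stepMean]
      fun_prop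
    · fun_prop
  have hm : ∀ y, P.map (regressionResidual V b B I)
      {x | (y, x) ∈ {p : ℝ × EuclideanSpace ℝ (Fin N) |
        (rescaledSteps V v a b p.1 p.2).ofLp ∈ walkExceeds N (p.1 - ε / V)}} =
      P {ω | (rescaledSteps V v a b y (regressionResidual V b B I ω)).ofLp ∈
        walkExceeds N (y - ε / V)} := fun y => by
    rw [Measure.map_apply h.measurable_regressionResidual]
    · rfl
    · exact measurable_prodMk_left hS
  refine ⟨?_, ?_⟩
  · rw [gridExceeds_eq B I b a ε hV hv, h.measure_eq hV hv hS]
    simp only [hm]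
  · have := Measure.isProbabilityMeasure_map (μ := P) h.measurable_regressionResidual.aemeasurable
    have h2 := measurable_measure_prodMk_left (ν := P.map (regressionResidual V b B I)) hS
    convert h2 using 1
    ext y
    exact (hm y).symm

theorem IsJointGaussian.charFun_rescaledSteps {B : Ω → ℝ} {I : Fin N → Ω → ℝ} {V : ℝ}
    {b : Fin N → ℝ} {G : Fin N → Fin N → ℝ} (h : IsJointGaussian P B I V b G) (hV : 0 < V)
    (v a y : ℝ) (c : EuclideanSpace ℝ (Fin N)) :
    charFun (P.map fun ω => rescaledSteps V v a b y (regressionResidual V b B I ω)) c =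
      Complex.exp (((∑ i, c i * stepMean V v a b y i : ℝ) : ℂ) * Complex.I - ((v ^ 2 / V ^ 2 *
        (∑ i, ∑ l, c i * c l * G i l - (∑ i, c i * b i) ^ 2 / V) / 2 : ℝ) : ℂ)) := by
  have h1 := (h.law_regressionResidual hV 0 fun i => v / V * c i).integral_cexp
  have hc : Continuous fun x : EuclideanSpace ℝ (Fin N) => rescaledSteps V v a b y x :=
    (continuous_rescaledSteps V v a b).comp (by fun_prop : Continuous fun x => (y, x))
  have hm : Measurable fun ω => rescaledSteps V v a b y (regressionResidual V b B I ω) :=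
    hc.measurable.comp h.measurable_regressionResidual
  rw [charFun_apply, integral_map hm.aemeasurable (by fun_prop), sub_eq_add_neg, Complex.exp_add]
  have h2 : (v ^ 2 / V ^ 2 * (∑ i, ∑ l, c i * c l * G i l - (∑ i, c i * b i) ^ 2 / V) / 2 : ℝ) =
    (0 ^ 2 * V + (∑ i, ∑ l, (v / V * c i) * (v / V * c l) * G i l -
      (∑ i, (v / V * c i) * b i) ^ 2 / V)) / 2 := by
    have e1 : ∑ i, ∑ l, v / V * c i * (v / V * c l) * G i l =
        (v / V) ^ 2 * ∑ i, ∑ l, c i * c l * G i l := by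
      simp only [Finset.mul_sum]
      exact Finset.sum_congr rfl fun i _ => Finset.sum_congr rfl fun l _ => by ring
    have e2 : ∑ i, v / V * c i * b i = (v / V) * ∑ i, c i * b i := by
      simp only [Finset.mul_sum]
      exact Finset.sum_congr rfl fun i _ => by ring
    rw [e1, e2]
    ring
  rw [h2, ← h1, ← integral_const_mul]
  refine integral_congr_ae (Eventually.of_forall fun ω => ?_)
  simp only [← Complex.exp_add]
  congr 1
  rw [← add_mul, ← Complex.ofReal_add]
  congr 2
  simp only [PiLp.inner_apply, rescaledSteps, zero_mul, zero_add]
  rw [← Finset.sum_add_distrib]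
  refine Finset.sum_congr rfl fun i _ => ?_
  simp
  ring

end Grid

/-- Along the sequence of levels `v`, the rescaled steps `I` behave like independent Gaussian steps
of mean `-qθ/2` and variance `q`. -/
structure IsWalkLimit {Ω : Type*} [MeasurableSpace Ω] {N : ℕ} (P : Measure Ω) (B : Ω → ℝ)
    (I : ℕ → Fin N → Ω → ℝ) (V : ℝ) (b : ℕ → Fin N → ℝ) (G : ℕ → Fin N → Fin N → ℝ)
    (v a : ℕ → ℝ) (q : ℝ≥0) (θ : ℝ) : Prop where
  pos : 0 < V
  joint : ∀ n, IsJointGaussian P B (I n) V (b n) (G n)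
  level : Tendsto v atTop atTop
  mean : ∀ i, Tendsto (fun n => b n i * v n ^ 2 / V ^ 2) atTop (nhds (-(q * θ / 2)))
  cov : ∀ i l, Tendsto (fun n => G n i l * v n ^ 2 / V ^ 2) atTop (nhds (if i = l then
      (q : ℝ) else 0))
  drift : Tendsto (fun n => v n * a n) atTop (nhds 0)

namespace IsWalkLimit

variable {Ω : Type*} [MeasurableSpace Ω] {N : ℕ} {P : Measure Ω} {B : Ω → ℝ}
    {I : ℕ → Fin N → Ω → ℝ} {V : ℝ} {b : ℕ → Fin N → ℝ} {G : ℕ → Fin N → Fin N → ℝ}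
    {v a : ℕ → ℝ} {q : ℝ≥0} {θ : ℝ}

theorem tendsto_cov_zero (h : IsWalkLimit P B I V b G v a q θ) (i : Fin N) :
    Tendsto (fun n => b n i) atTop (nhds 0) := by
  have h1 : Tendsto (fun n => (v n ^ 2)⁻¹ * V ^ 2) atTop (nhds (0 * V ^ 2)) :=
    (((tendsto_pow_atTop two_ne_zero).comp h.level).inv_tendsto_atTop).mul_const _
  have h2 := (h.mean i).mul h1
  rw [zero_mul, mul_zero] at h2
  refine h2.congr' ?_
  filter_upwards [h.level.eventually_gt_atTop 0] with n hn
  have := h.pos.ne'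
  field_simp

theorem tendsto_stepMean (h : IsWalkLimit P B I V b G v a q θ) (y : ℝ) (i : Fin N) :
    Tendsto (fun n => stepMean V (v n) (a n) (b n) y i) atTop (nhds (-(q * θ / 2))) := by
  have h1 := ((h.mean i).sub (((h.tendsto_cov_zero i).mul_const y).div_const V)).add
    (h.drift.div_const V)
  simpa [stepMean] using h1

theorem tendsto_quadratic (h : IsWalkLimit P B I V b G v a q θ) (c : Fin N → ℝ) :
    Tendsto (fun n => v n ^ 2 / V ^ 2 *
      (∑ i, ∑ l, c i * c l * G n i l - (∑ i, c i * b n i) ^ 2 / V)) atTop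
      (nhds (q * ∑ i, c i ^ 2)) := by
  have h1 : Tendsto (fun n => ∑ i, ∑ l, c i * c l * (G n i l * v n ^ 2 / V ^ 2)) atTop
      (nhds (∑ i, ∑ l, c i * c l * (if i = l then (q : ℝ) else 0))) :=
    tendsto_finsetSum _ fun i _ => tendsto_finsetSum _ fun l _ => (h.cov i l).const_mul _
  have h2 : Tendsto (fun n => (∑ i, c i * b n i) * (∑ i, c i * (b n i * v n ^ 2 / V ^ 2)) / V) atTop
      (nhds ((∑ i, c i * 0) * (∑ i, c i * (-(q * θ / 2))) / V)) :=
    ((tendsto_finsetSum _ fun i _ => (h.tendsto_cov_zero i).const_mul _).mul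
      (tendsto_finsetSum _ fun i _ => (h.mean i).const_mul _)).div_const V
  convert h1.sub h2 using 1
  · ext n
    have e1 : ∑ i, ∑ l, c i * c l * (G n i l * v n ^ 2 / V ^ 2) =
        v n ^ 2 / V ^ 2 * ∑ i, ∑ l, c i * c l * G n i l := by
      simp only [Finset.mul_sum]
      exact Finset.sum_congr rfl fun i _ => Finset.sum_congr rfl fun l _ => by ring
    have e2 : ∑ i, c i * (b n i * v n ^ 2 / V ^ 2) = v n ^ 2 / V ^ 2 * ∑ i, c i * b n i := by
      simp only [Finset.mul_sum]
      exact Finset.sum_congr rfl fun i _ => by ring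
    rw [e1, e2]
    ring
  · congr 1
    simp only [mul_zero, Finset.sum_const_zero, zero_mul, zero_div, sub_zero, mul_ite,
      Finset.sum_ite_eq, Finset.mem_univ, if_true, Finset.mul_sum]
    exact Finset.sum_congr rfl fun i _ => by ring

variable [IsProbabilityMeasure P]

theorem measurable_rescaledSteps (h : IsWalkLimit P B I V b G v a q θ) (y : ℝ) (n : ℕ) :
    Measurable fun ω => rescaledSteps V (v n) (a n) (b n) y
      (regressionResidual V (b n) B (I n) ω) := by
  have hc : Continuous fun x : EuclideanSpace ℝ (Fin N) => rescaledSteps V (v n) (a n) (b n) y x :=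
    (continuous_rescaledSteps V (v n) (a n) (b n)).comp (by fun_prop : Continuous fun x => (y, x))
  exact hc.measurable.comp (h.joint n).measurable_regressionResidual

theorem tendsto_law (h : IsWalkLimit P B I V b G v a q θ) (y : ℝ) :
    ∃ (π : ProbabilityMeasure (EuclideanSpace ℝ (Fin N)))
      (μ : ℕ → ProbabilityMeasure (EuclideanSpace ℝ (Fin N))),
      (π : Measure (EuclideanSpace ℝ (Fin N))) =
        (Measure.pi fun _ : Fin N => gaussianReal (-(q * θ / 2)) q).map (WithLp.toLp 2) ∧
      (∀ n, (μ n : Measure (EuclideanSpace ℝ (Fin N))) = P.map fun ω =>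
        rescaledSteps V (v n) (a n) (b n) y (regressionResidual V (b n) B (I n) ω)) ∧
      Tendsto μ atTop (nhds π) := by
  refine ⟨⟨(Measure.pi fun _ : Fin N => gaussianReal (-(q * θ / 2)) q).map (WithLp.toLp 2),
    Measure.isProbabilityMeasure_map (by fun_prop)⟩, fun n => ⟨P.map fun ω =>
        rescaledSteps V (v n) (a n) (b n) y (regressionResidual V (b n) B (I n) ω),
    Measure.isProbabilityMeasure_map (h.measurable_rescaledSteps y n).aemeasurable⟩, rfl,
    fun n => rfl, ProbabilityMeasure.tendsto_of_tendsto_charFun fun c => ?_⟩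
  simp only [ProbabilityMeasure.coe_mk]
  have h1 : ∀ n, charFun (P.map fun ω => rescaledSteps V (v n) (a n) (b n) y
      (regressionResidual V (b n) B (I n) ω)) c = _ := fun n =>
    (h.joint n).charFun_rescaledSteps h.pos (v n) (a n) y c
  simp only [h1]
  rw [charFun_pi]
  simp only [charFun_gaussianReal, ← Complex.exp_sum]
  refine (Complex.continuous_exp.tendsto _).comp ?_
  have h2 : Tendsto (fun n => ∑ i, c i * stepMean V (v n) (a n) (b n) y i) atTop
      (nhds (∑ i, c i * -(q * θ / 2))) :=
    tendsto_finsetSum _ fun i _ => (h.tendsto_stepMean y i).const_mul _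
  have h3 := (h.tendsto_quadratic c).div_const 2
  have h4 := (((Complex.continuous_ofReal.tendsto _).comp h2).mul_const Complex.I).sub
    ((Complex.continuous_ofReal.tendsto _).comp h3)
  convert h4 using 1
  congr 1
  push_cast
  rw [Finset.sum_mul, Finset.mul_sum, Finset.sum_div, ← Finset.sum_sub_distrib]

theorem le_liminf_conditional (h : IsWalkLimit P B I V b G v a q θ) (y z : ℝ) :
    walkProb (-(q * θ / 2)) q N z ≤ liminf (fun n => P {ω | (rescaledSteps V (v n) (a n) (b n) y
        (regressionResidual V (b n) B (I n) ω)).ofLp ∈ walkExceeds N z}) atTop := by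
  obtain ⟨π, μ, hπ, hμ, ht⟩ := h.tendsto_law y
  have ho : IsOpen {x : EuclideanSpace ℝ (Fin N) | x.ofLp ∈ walkExceeds N z} :=
    (isOpen_walkExceeds N z).preimage (PiLp.continuous_ofLp 2 _)
  have h1 := ProbabilityMeasure.le_liminf_measure_open_of_tendsto ht ho
  rw [hπ, Measure.map_apply (by fun_prop) ho.measurableSet] at h1
  refine h1.trans_eq ?_
  congr 1
  ext n
  rw [hμ, Measure.map_apply (h.measurable_rescaledSteps y n) ho.measurableSet]
  rfl

theorem limsup_conditional_le (h : IsWalkLimit P B I V b G v a q θ) (y z : ℝ) {η : ℝ} (hη : 0 < η) :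
    limsup (fun n => P {ω | (rescaledSteps V (v n) (a n) (b n) y
        (regressionResidual V (b n) B (I n) ω)).ofLp ∈ walkExceeds N z}) atTop ≤
      walkProb (-(q * θ / 2)) q N (z - η) := by
  obtain ⟨π, μ, hπ, hμ, ht⟩ := h.tendsto_law y
  set F : Set (EuclideanSpace ℝ (Fin N)) :=
    {x | ∃ k ≤ N, z ≤ ∑ i : Fin N, if (i : ℕ) < k then x i else 0} with hF
  have hc : IsClosed F := by
    have : F = ⋃ k ∈ (Finset.range (N + 1) : Set ℕ),
        {x : EuclideanSpace ℝ (Fin N) | z ≤ ∑ i : Fin N, if (i : ℕ) < k then x i else 0} := by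
      ext x; simp [hF]
    rw [this]
    refine Set.Finite.isClosed_biUnion (Finset.finite_toSet _) fun k _ =>
      isClosed_le continuous_const ?_
    refine continuous_finsetSum _ fun i _ => ?_
    split_ifs <;> fun_prop
  have h1 := ProbabilityMeasure.limsup_measure_closed_le_of_tendsto ht hc
  rw [hπ, Measure.map_apply (by fun_prop) hc.measurableSet] at h1
  refine le_trans (limsup_le_limsup (Eventually.of_forall fun n => ?_)) (h1.trans ?_)
  · dsimp only
    rw [hμ, Measure.map_apply (h.measurable_rescaledSteps y n) hc.measurableSet]
    refine measure_mono ?_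
    rintro ω ⟨k, hk, hω⟩
    exact ⟨k, hk, hω.le⟩
  · refine measure_mono ?_
    rintro ω ⟨k, hk, hω⟩
    exact ⟨k, hk, lt_of_lt_of_le (by linarith) hω⟩

theorem le_liminf_gridExceeds (h : IsWalkLimit P B I V b G v a q θ) :
    ∫⁻ y, ENNReal.ofReal (Real.exp y) * walkProb (-(q * θ / 2)) q N y ≤
      liminf (fun n => P (gridExceeds B (I n) (a n) (v n) 0) /
        ENNReal.ofReal (tailNorm V (v n))) atTop := by
  set w : ℕ → ℝ → ℝ≥0∞ := fun n y => P {ω | (rescaledSteps V (v n) (a n) (b n) y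
        (regressionResidual V (b n) B (I n) ω)).ofLp ∈ walkExceeds N (y - 0 / V)} with hw
  have h1 : ∀ᶠ n in atTop, P (gridExceeds B (I n) (a n) (v n) 0) /
        ENNReal.ofReal (tailNorm V (v n)) = ∫⁻ y, tailDensity V (v n) y * w n y := by
    filter_upwards [h.level.eventually_gt_atTop 0] with n hn
    rw [(measure_gridExceeds (h.joint n) h.pos (a n) 0 hn).1, mul_comm,
      ENNReal.mul_div_cancel_right (by simpa using tailNorm_pos h.pos hn) ENNReal.ofReal_ne_top]
  rw [liminf_congr h1]
  obtain ⟨n₀, hn₀⟩ := eventually_atTop.1 (h.level.eventually_gt_atTop 0)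
  rw [← liminf_nat_add _ n₀]
  refine le_trans (lintegral_mono fun y => ?_) (lintegral_liminf_le fun n =>
    (measurable_tailDensity V _).mul
      (measure_gridExceeds (h.joint (n + n₀)) h.pos (a _) 0 (hn₀ _ (by simp))).2)
  rw [liminf_nat_add (fun n => tailDensity V (v n) y * w n y) n₀]
  refine le_trans ?_ ENNReal.le_liminf_mul
  gcongr
  · refine (Tendsto.liminf_eq ?_).ge
    refine (ENNReal.continuous_ofReal.tendsto _).comp ((Real.continuous_exp.tendsto _).comp ?_)
    have : Tendsto (fun n => y ^ 2 * V / (2 * v n ^ 2)) atTop (nhds 0) :=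
      tendsto_const_nhds.div_atTop (Tendsto.const_mul_atTop two_pos
        ((tendsto_pow_atTop two_ne_zero).comp h.level))
    simpa using tendsto_const_nhds.sub this
  · simp only [hw, zero_div, sub_zero]
    exact h.le_liminf_conditional y y

end IsWalkLimit

namespace IsWalkLimit

variable {Ω : Type*} [MeasurableSpace Ω] {N : ℕ} {P : Measure Ω} {B : Ω → ℝ}
    {I : ℕ → Fin N → Ω → ℝ} {V : ℝ} {b : ℕ → Fin N → ℝ} {G : ℕ → Fin N → Fin N → ℝ}
    {v a : ℕ → ℝ} {q : ℝ≥0} {θ : ℝ}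

theorem eventually_conditional_sum_le (h : IsWalkLimit P B I V b G v a q θ) (ε : ℝ)
    (c : Fin N → ℝ) :
    ∃ C, ∀ᶠ n in atTop, ∀ y, 0 ≤ y →
      P {ω | y - ε / V ≤ ∑ i, c i * (rescaledSteps V (v n) (a n) (b n) y
        (regressionResidual V (b n) B (I n) ω)) i} ≤
      ENNReal.ofReal (Real.exp (C + -(3 / 2) * y)) := by
  have h1 : Tendsto (fun n => ∑ i, c i * stepMean V (v n) (a n) (b n) 0 i) atTop
      (nhds (∑ i, c i * -(q * θ / 2))) :=
    tendsto_finsetSum _ fun i _ => (h.tendsto_stepMean 0 i).const_mul _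
  have h2 := h.tendsto_quadratic c
  have h3 : Tendsto (fun n => (∑ i, c i * b n i) / V) atTop (nhds 0) := by
    have : Tendsto (fun n => (∑ i, c i * b n i) / V) atTop (nhds ((∑ i, c i * 0) / V)) :=
      (tendsto_finsetSum _ fun i _ => (h.tendsto_cov_zero i).const_mul _).div_const V
    simpa using this
  refine ⟨2 * (ε / V) + 2 * ((∑ i, c i * -(q * θ / 2)) + 1) + 2 * (q * ∑ i, c i ^ 2 + 1), ?_⟩
  filter_upwards [h1.eventually_lt_const (lt_add_one _), h2.eventually_lt_const (lt_add_one _),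
    h3.eventually_const_lt (show (-(1 / 4) : ℝ) < 0 by norm_num)] with n hn1 hn2 hn3 y hy
  have h4 := ((h.joint n).law_regressionResidual h.pos 0 fun i => v n / V * c i).measure_le
    (y - ε / V - ∑ i, c i * stepMean V (v n) (a n) (b n) y i) zero_le_two
  refine le_trans (measure_mono ?_) (h4.trans (ENNReal.ofReal_le_ofReal (Real.exp_le_exp.2 ?_)))
  · intro ω hω
    simp only [mem_ofPred_eq, rescaledSteps, mul_add, Finset.sum_add_distrib] at hω ⊢
    have : ∑ i, v n / V * c i * (regressionResidual V (b n) B (I n) ω) i =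
        ∑ i, c i * (v n / V * (regressionResidual V (b n) B (I n) ω) i) :=
      Finset.sum_congr rfl fun i _ => by ring
    rw [this]
    linarith
  · have e0 : ∑ i, c i * stepMean V (v n) (a n) (b n) y i =
        ∑ i, c i * stepMean V (v n) (a n) (b n) 0 i - (∑ i, c i * b n i) / V * y := by
      rw [Finset.sum_div, Finset.sum_mul, ← Finset.sum_sub_distrib]
      refine Finset.sum_congr rfl fun i _ => ?_
      simp only [stepMean]
      ring
    have e1 : ∑ i, ∑ l, v n / V * c i * (v n / V * c l) * G n i l =
        (v n / V) ^ 2 * ∑ i, ∑ l, c i * c l * G n i l := by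
      simp only [Finset.mul_sum]
      exact Finset.sum_congr rfl fun i _ => Finset.sum_congr rfl fun l _ => by ring
    have e2 : ∑ i, v n / V * c i * b n i = (v n / V) * ∑ i, c i * b n i := by
      simp only [Finset.mul_sum]
      exact Finset.sum_congr rfl fun i _ => by ring
    rw [e0, e1, e2]
    have e3 : (0 ^ 2 * V + ((v n / V) ^ 2 * ∑ i, ∑ l, c i * c l * G n i l -
        (v n / V * ∑ i, c i * b n i) ^ 2 / V)) = v n ^ 2 / V ^ 2 *
      (∑ i, ∑ l, c i * c l * G n i l - (∑ i, c i * b n i) ^ 2 / V) := by ring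
    rw [e3]
    nlinarith [mul_le_mul_of_nonneg_right hn3.le hy]

theorem eventually_conditional_le (h : IsWalkLimit P B I V b G v a q θ) (ε : ℝ) :
    ∃ C : ℝ≥0∞, C ≠ ∞ ∧ ∀ᶠ n in atTop, ∀ y, 0 ≤ y →
      P {ω | (rescaledSteps V (v n) (a n) (b n) y
        (regressionResidual V (b n) B (I n) ω)).ofLp ∈ walkExceeds N (y - ε / V)} ≤
      C * ENNReal.ofReal (Real.exp (-(3 / 2) * y)) := by
  choose C hC using fun k : ℕ =>
    h.eventually_conditional_sum_le ε fun i : Fin N => if (i : ℕ) < k then 1 else 0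
  refine ⟨∑ k ∈ Finset.range (N + 1), ENNReal.ofReal (Real.exp (C k)),
    ENNReal.sum_ne_top.2 fun _ _ => ENNReal.ofReal_ne_top, ?_⟩
  have h1 := (Finset.eventually_all (Finset.range (N + 1))).2 fun k _ => hC k
  filter_upwards [h1] with n hn y hy
  rw [Finset.sum_mul]
  refine le_trans (measure_mono ?_) ((measure_biUnion_finset_le _ _).trans
    (Finset.sum_le_sum fun k hk => (hn k hk y hy).trans_eq ?_))
  · rintro ω ⟨k, hk, hω⟩
    simp only [mem_iUnion]
    refine ⟨k, Finset.mem_range.2 (by omega), ?_⟩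
    simpa using hω.le
  · rw [Real.exp_add, ENNReal.ofReal_mul (Real.exp_pos _).le]

variable [IsProbabilityMeasure P]

theorem limsup_gridExceeds_le (h : IsWalkLimit P B I V b G v a q θ) (ε : ℝ) {η : ℝ} (hη : 0 < η) :
    limsup (fun n => P (gridExceeds B (I n) (a n) (v n) ε) /
        ENNReal.ofReal (tailNorm V (v n))) atTop ≤
      ∫⁻ y, ENNReal.ofReal (Real.exp y) * walkProb (-(q * θ / 2)) q N (y - (ε / V + η)) := by
  set w : ℕ → ℝ → ℝ≥0∞ := fun n y => P {ω | (rescaledSteps V (v n) (a n) (b n) y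
        (regressionResidual V (b n) B (I n) ω)).ofLp ∈ walkExceeds N (y - ε / V)} with hw
  have h1 : ∀ᶠ n in atTop, P (gridExceeds B (I n) (a n) (v n) ε) /
        ENNReal.ofReal (tailNorm V (v n)) = ∫⁻ y, tailDensity V (v n) y * w n y := by
    filter_upwards [h.level.eventually_gt_atTop 0] with n hn
    rw [(measure_gridExceeds (h.joint n) h.pos (a n) ε hn).1, mul_comm,
      ENNReal.mul_div_cancel_right (by simpa using tailNorm_pos h.pos hn) ENNReal.ofReal_ne_top]
  rw [limsup_congr h1]
  obtain ⟨C, hC, hdom⟩ := h.eventually_conditional_le ε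
  obtain ⟨n₀, hn₀⟩ := eventually_atTop.1 (hdom.and (h.level.eventually_gt_atTop 0))
  rw [← limsup_nat_add _ n₀]
  have hle : ∀ n y, tailDensity V (v n) y ≤ ENNReal.ofReal (Real.exp y) := fun n y => by
    refine ENNReal.ofReal_le_ofReal (Real.exp_le_exp.2 ?_)
    have : 0 ≤ y ^ 2 * V / (2 * v n ^ 2) := by have := h.pos; positivity
    linarith
  set bound : ℝ → ℝ≥0∞ := fun y => (Iic 0).indicator (fun y => ENNReal.ofReal (Real.exp y)) y +
    C * (Ioi 0).indicator (fun y => ENNReal.ofReal (Real.exp (-(1 / 2) * y))) y with hbound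
  refine le_trans (limsup_lintegral_le bound (fun n => (measurable_tailDensity V _).mul
      (measure_gridExceeds (h.joint (n + n₀)) h.pos (a _) ε (hn₀ _ (by simp)).2).2)
      (fun n => Eventually.of_forall fun y => ?_) ?_) (lintegral_mono fun y => ?_)
  · rcases le_or_gt y 0 with hy | hy
    · have : bound y = ENNReal.ofReal (Real.exp y) := by simp [hbound, hy]
      rw [this]
      exact (mul_le_mul' (hle _ y) prob_le_one).trans_eq (mul_one _)
    · have : bound y = C * ENNReal.ofReal (Real.exp (-(1 / 2) * y)) := by
        simp [hbound, hy, hy.not_ge]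
      rw [this]
      refine (mul_le_mul' (hle _ y) ((hn₀ (n + n₀) (by simp)).1 y hy.le)).trans_eq ?_
      rw [mul_left_comm, ← ENNReal.ofReal_mul (Real.exp_pos _).le, ← Real.exp_add]
      congr 4
      ring
  · rw [lintegral_add_left ((by fun_prop : Measurable fun y : ℝ =>
      ENNReal.ofReal (Real.exp y)).indicator measurableSet_Iic), lintegral_const_mul _
      ((by fun_prop : Measurable fun y : ℝ => ENNReal.ofReal (Real.exp (-(1 / 2) * y))).indicator
      measurableSet_Ioi), lintegral_indicator measurableSet_Iic,
      lintegral_indicator measurableSet_Ioi, lintegral_exp_Iic, lintegral_exp_mul_Ioi (by norm_num)]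
    exact ENNReal.add_ne_top.2 ⟨ENNReal.ofReal_ne_top, ENNReal.mul_ne_top hC ENNReal.ofReal_ne_top⟩
  · rw [limsup_nat_add (fun n => tailDensity V (v n) y * w n y) n₀]
    refine (limsup_le_limsup (Eventually.of_forall fun n => mul_le_mul_left (hle n y) _)).trans ?_
    rw [ENNReal.limsup_const_mul_of_ne_top ENNReal.ofReal_ne_top]
    gcongr
    have := h.limsup_conditional_le y (y - ε / V) hη
    rwa [sub_sub] at this

end IsWalkLimit

/-! ### Non-asymptotic tail bounds -/

section Tail

variable {Ω : Type*} [MeasurableSpace Ω] {P : Measure Ω}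

theorem IsCenteredGaussian.measure_lt_le {Y : Ω → ℝ} {s : ℝ} (h : IsCenteredGaussian P Y s)
    {b : ℝ} (hb : 0 < b) : P {ω | b < Y ω} ≤ ENNReal.ofReal (tailNorm s b) := by
  have h0 : P {ω | b < Y ω} = gaussianReal 0 s.toNNReal (Ioi b) := by
    rw [← h.2, Measure.map_apply_of_aemeasurable h.aemeasurable measurableSet_Ioi]
    rfl
  rw [h0]
  rcases h.1.eq_or_lt with hs | hs
  · rw [← hs]
    simp [hb.le]
  · have h1 : gaussianReal 0 s.toNNReal (Ioi b) =
        (gaussianReal 0 s.toNNReal).map (fun x => b * (b - x) / s) (Iio 0) := by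
      rw [Measure.map_apply (by fun_prop) measurableSet_Iio]
      congr 1
      ext x
      simp only [mem_Ioi, mem_preimage, mem_Iio]
      rw [div_lt_iff₀ hs, zero_mul]
      constructor
      · intro hx
        nlinarith
      · intro hx
        nlinarith
    rw [h1, map_gaussianReal_rescale hs hb, withDensity_apply _ measurableSet_Iio,
      lintegral_const_mul _ (measurable_tailDensity s b)]
    refine (mul_le_mul' le_rfl ?_).trans_eq (mul_one _)
    have h2 := lintegral_exp_Iic 0
    rw [Real.exp_zero, ENNReal.ofReal_one, setLIntegral_congr Iio_ae_eq_Iic.symm] at h2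
    rw [← h2]
    refine lintegral_mono fun y => ENNReal.ofReal_le_ofReal (Real.exp_le_exp.2 ?_)
    have : 0 ≤ y ^ 2 * s / (2 * b ^ 2) := by positivity
    linarith

/-- Tail of a Gaussian variable at distance `h` from the point of maximal variance. -/
theorem IsCenteredGaussian.measure_lt_le_exp {Y : Ω → ℝ} {s : ℝ} (hY : IsCenteredGaussian P Y s)
    {V T h v κ M : ℝ} (hV : 0 < V) (hT : 0 < T) (hs : s ≤ V * (1 - h / T)) (hh : 0 ≤ h)
    (hhT : h ≤ T) (hκ : 0 ≤ κ) (hM : 0 ≤ M) (hv : 0 < v) (hvM : 8 * M * T ≤ v)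
    (hvκ : 4 * κ ≤ v ^ 2) :
    P {ω | v - κ / v - M * h < Y ω} ≤ ENNReal.ofReal (2 * Real.exp (2 * κ / V) *
      Real.exp (-(h * v ^ 2 / (4 * V * T))) * tailNorm V v) := by
  have hκv : κ / v ≤ v / 4 := by rw [div_le_iff₀ hv]; nlinarith
  have hMh : M * h ≤ v / 8 := by nlinarith [mul_le_mul_of_nonneg_left hhT hM]
  set b := v - κ / v - M * h with hbdef
  have hb : v / 2 ≤ b := by linarith
  have hb0 : 0 < b := by linarith
  refine (hY.measure_lt_le hb0).trans (ENNReal.ofReal_le_ofReal ?_)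
  rcases hY.1.eq_or_lt with hs0 | hs0
  · rw [← hs0]
    have := tailNorm_pos hV hv
    simp only [tailNorm, Real.sqrt_zero, zero_div, zero_mul]
    positivity
  have hhT1 : 0 ≤ h / T := by positivity
  have hhT2 : h / T ≤ 1 := (div_le_one hT).2 hhT
  have hsV : s ≤ V := by nlinarith
  have hinv : (1 + h / T) / V ≤ 1 / s := by
    rw [div_le_div_iff₀ hV hs0]
    nlinarith [mul_nonneg hhT1 hhT1]
  have hb2 : v ^ 2 - 2 * κ - 2 * M * h * v ≤ b ^ 2 := by
    have e : b ^ 2 = v ^ 2 - 2 * κ - 2 * M * h * v + (κ / v + M * h) ^ 2 := by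
      rw [hbdef]; field_simp; ring
    rw [e]
    linarith [sq_nonneg (κ / v + M * h)]
  have hexp : v ^ 2 / (2 * V) + h * v ^ 2 / (4 * V * T) - 2 * κ / V ≤ b ^ 2 / (2 * s) := by
    have h1 : b ^ 2 / (2 * s) = b ^ 2 / 2 * (1 / s) := by field_simp
    rw [h1]
    refine le_trans ?_ (mul_le_mul_of_nonneg_left hinv (by positivity))
    have h2 : v ^ 2 / (2 * V) + h * v ^ 2 / (4 * V * T) - 2 * κ / V =
      (v ^ 2 + (h / T) * v ^ 2 / 2 - 4 * κ) / 2 * (1 / V) := by field_simp; ring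
    have h3 : b ^ 2 / 2 * ((1 + h / T) / V) = (b ^ 2 * (1 + h / T)) / 2 * (1 / V) := by
      field_simp
    rw [h2, h3]
    refine mul_le_mul_of_nonneg_right ?_ (by positivity)
    have h4 : 4 * M * h * v ≤ h / T * v ^ 2 / 2 := by
      have : h / T * v ^ 2 / 2 - 4 * M * h * v = h / T * v / 2 * (v - 8 * M * T) := by
        field_simp; ring
      have h5 : 0 ≤ h / T * v / 2 * (v - 8 * M * T) := by
        have := sub_nonneg.2 hvM; positivity
      linarith
    have h6 : (v ^ 2 - 2 * κ - 2 * M * h * v) * (1 + h / T) ≤ b ^ 2 * (1 + h / T) := by gcongr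
    have h7 : (2 * κ + 2 * M * h * v) * (1 + h / T) ≤ (2 * κ + 2 * M * h * v) * 2 := by
      gcongr; linarith
    nlinarith
  have hfac : Real.sqrt s / (b * Real.sqrt (2 * Real.pi)) ≤
      2 * (Real.sqrt V / (v * Real.sqrt (2 * Real.pi))) := by
    have h1 : 2 * (Real.sqrt V / (v * Real.sqrt (2 * Real.pi))) =
      Real.sqrt V / (v / 2 * Real.sqrt (2 * Real.pi)) := by field_simp
    rw [h1]
    gcongr
  unfold tailNorm
  calc _ ≤ 2 * (Real.sqrt V / (v * Real.sqrt (2 * Real.pi))) *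
        Real.exp (-(v ^ 2 / (2 * V) + h * v ^ 2 / (4 * V * T) - 2 * κ / V)) := by gcongr
    _ = _ := by
      rw [show -(v ^ 2 / (2 * V) + h * v ^ 2 / (4 * V * T) - 2 * κ / V) =
        2 * κ / V + -(h * v ^ 2 / (4 * V * T)) + -(v ^ 2 / (2 * V)) by ring, Real.exp_add,
        Real.exp_add]
      ring

theorem IsJointGaussian.measure_pair_le [IsProbabilityMeasure P] {B : Ω → ℝ} {I : Fin 1 → Ω → ℝ}
    {V : ℝ} {b : Fin 1 → ℝ} {G : Fin 1 → Fin 1 → ℝ} (h : IsJointGaussian P B I V b G) (hV : 0 < V)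
    (x η : ℝ) {β : ℝ} (hβ : 0 ≤ β) :
    P {ω | x < B ω ∧ η ≤ I 0 ω} ≤ ENNReal.ofReal (Real.exp (-(β * η) + β ^ 2 * G 0 0 / 2)) *
      P {ω | x - β * b 0 < B ω} := by
  have hmB := h.measurable_fst
  have hmI := h.measurable_snd 0
  set V' := V.toNNReal with hV'
  have hVc : (V' : ℝ) = V := Real.coe_toNNReal _ hV.le
  have hV0 : V' ≠ 0 := by simpa [hV'] using hV
  have hB : P.map B = gaussianReal 0 V' := by
    have := (h.law 1 0).2
    simpa using this
  have hm := h.measurable_fst.prodMk h.measurable_regressionResidual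
  have := Measure.isProbabilityMeasure_map (μ := P) h.measurable_regressionResidual.aemeasurable
  -- the exponential moment of the residual
  have hres := (h.law_regressionResidual hV 0 fun _ => 1)
  simp only [zero_mul, zero_add, Finset.univ_unique, Fin.default_eq_zero, Fin.isValue,
    Finset.sum_singleton, one_mul, ne_eq, OfNat.ofNat_ne_zero, not_false_eq_true, zero_pow] at hres
  have hmr : Measurable fun ω => (regressionResidual V b B I ω) 0 := by
    simp only [regressionResidual]; fun_prop
  have hmom : ∫⁻ ω, ENNReal.ofReal (Real.exp (β * (regressionResidual V b B I ω) 0)) ∂P =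
      ENNReal.ofReal (Real.exp (β ^ 2 * (G 0 0 - b 0 ^ 2 / V) / 2)) := by
    have h1 : ∫⁻ ω, ENNReal.ofReal (Real.exp (β * (regressionResidual V b B I ω) 0)) ∂P =
        ∫⁻ z, ENNReal.ofReal (Real.exp (β * z)) ∂(gaussianReal 0
            (G 0 0 - b 0 ^ 2 / V).toNNReal) := by
      rw [← hres.2, lintegral_map (by fun_prop) hmr]
    rw [h1, ← ofReal_integral_eq_lintegral_ofReal (integrable_exp_mul_gaussianReal β)
      (Eventually.of_forall fun _ => (Real.exp_pos _).le)]
    have h2 := mgf_id_gaussianReal (μ := 0) (v := (G 0 0 - b 0 ^ 2 / V).toNNReal)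
    have h3 := congrFun h2 β
    simp only [mgf, id] at h3
    rw [h3, Real.coe_toNNReal _ hres.1]
    congr 2
    ring
  set ρ := b 0 / V with hρ
  have hind : P {ω | x < B ω ∧ η ≤ I 0 ω} ≤ ∫⁻ ω, (Ioi x).indicator (fun z => ENNReal.ofReal
      (Real.exp (β * ρ * z))) (B ω) * (ENNReal.ofReal (Real.exp (-(β * η))) *
      ENNReal.ofReal (Real.exp (β * (regressionResidual V b B I ω) 0))) ∂P := by
    have hms : MeasurableSet {ω | x < B ω ∧ η ≤ I 0 ω} :=
      (measurableSet_lt measurable_const hmB).inter (measurableSet_le measurable_const hmI)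
    rw [← lintegral_indicator_one hms]
    refine lintegral_mono fun ω => ?_
    by_cases hω : x < B ω ∧ η ≤ I 0 ω
    · rw [indicator_of_mem (by exact hω), indicator_of_mem (by exact hω.1), Pi.one_apply,
        ← ENNReal.ofReal_mul (Real.exp_pos _).le, ← ENNReal.ofReal_mul (Real.exp_pos _).le,
        ← Real.exp_add, ← Real.exp_add, ← ENNReal.ofReal_one]
      refine ENNReal.ofReal_le_ofReal (Real.one_le_exp ?_)
      simp only [regressionResidual]
      nlinarith [mul_le_mul_of_nonneg_left hω.2 hβ]
    · rw [indicator_of_notMem (by exact hω)]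
      exact zero_le
  refine hind.trans ?_
  have hprod : ∫⁻ ω, (Ioi x).indicator (fun z => ENNReal.ofReal
      (Real.exp (β * ρ * z))) (B ω) * (ENNReal.ofReal (Real.exp (-(β * η))) *
      ENNReal.ofReal (Real.exp (β * (regressionResidual V b B I ω) 0))) ∂P =
      (∫⁻ z, (Ioi x).indicator (fun z => ENNReal.ofReal (Real.exp (β * ρ * z))) z
        ∂(gaussianReal 0 V')) *
      ∫⁻ ω, (ENNReal.ofReal (Real.exp (-(β * η))) *
        ENNReal.ofReal (Real.exp (β * (regressionResidual V b B I ω) 0))) ∂P := by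
    have hf : Measurable fun z => (Ioi x).indicator
        (fun z => ENNReal.ofReal (Real.exp (β * ρ * z))) z :=
      (by fun_prop : Measurable fun z : ℝ => ENNReal.ofReal (Real.exp (β * ρ * z))).indicator
        measurableSet_Ioi
    have hg : Measurable fun z : EuclideanSpace ℝ (Fin 1) => ENNReal.ofReal (Real.exp (-(β * η))) *
        ENNReal.ofReal (Real.exp (β * z 0)) := by fun_prop
    have h1 := lintegral_map (μ := P) ((hf.comp _root_.measurable_fst).mul
      (hg.comp _root_.measurable_snd)) hm
    have h2 := lintegral_map (μ := P) hg h.measurable_regressionResidual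
    have h3 := lintegral_prod_mul (μ := gaussianReal 0 V')
      (ν := P.map (regressionResidual V b B I)) hf.aemeasurable hg.aemeasurable
    rw [h.map_prod hV] at h1
    rw [← h2, ← h3]
    exact h1.symm
  rw [hprod, lintegral_const_mul _ (by fun_prop), hmom]
  have htilt := lintegral_gaussianReal_exp_mul 0 (β * ρ) hV0 (f := (Ioi x).indicator 1)
    (measurable_one.indicator measurableSet_Ioi)
  have hsh : P {ω | x - β * b 0 < B ω} = gaussianReal (0 + β * ρ * V') V' (Ioi x) := by
    have h1 := gaussianReal_map_add_const (μ := 0) (v := V') (β * ρ * V')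
    rw [← h1, Measure.map_apply (by fun_prop) measurableSet_Ioi, ← hB,
      Measure.map_apply hmB ((measurable_add_const _) measurableSet_Ioi)]
    congr 1
    ext ω
    simp only [mem_ofPred_eq, mem_preimage, mem_Ioi, hVc, hρ]
    rw [show β * (b 0 / V) * V = β * b 0 by field_simp]
    constructor <;> intro h <;> linarith
  have hL : ∫⁻ z, (Ioi x).indicator (fun z => ENNReal.ofReal (Real.exp (β * ρ * z))) z
        ∂(gaussianReal 0 V') = ENNReal.ofReal (Real.exp (V * (β * ρ) ^ 2 / 2)) *
        P {ω | x - β * b 0 < B ω} := by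
    rw [hsh]
    rw [lintegral_indicator_one measurableSet_Ioi] at htilt
    rw [zero_mul, zero_add, hVc] at htilt
    rw [hVc, ← htilt]
    refine lintegral_congr fun z => ?_
    by_cases hz : z ∈ Ioi x <;> simp [hz, indicator_of_notMem, indicator_of_mem]
  rw [hL, mul_right_comm, ← ENNReal.ofReal_mul (Real.exp_pos _).le, ← Real.exp_add,
    ← ENNReal.ofReal_mul (Real.exp_pos _).le, ← Real.exp_add]
  refine le_of_eq ?_
  congr 3
  rw [hρ]
  field_simp
  ring

end Tail

/-! ### Gaussian processes with a given covariance -/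

/-- `Z` is a centered Gaussian process on `[0,T]` with covariance `R`. -/
structure IsGaussianWithCov {Ω : Type*} [MeasurableSpace Ω] (P : Measure Ω) (T : ℝ)
    (Z : ℝ → Ω → ℝ) (R : ℝ → ℝ → ℝ) : Prop where
  symm : ∀ s t, R s t = R t s
  measurable : ∀ t ∈ Icc 0 T, Measurable (Z t)
  law : ∀ (k : ℕ) (c : Fin k → ℝ) (t : Fin k → ℝ), (∀ j, t j ∈ Icc 0 T) →
    IsCenteredGaussian P (fun ω => ∑ j, c j * Z (t j) ω) (∑ i, ∑ j, c i * c j * R (t i) (t j))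

/-- The variance of the increment between `s` and `t`. -/
def incrementVar (R : ℝ → ℝ → ℝ) (s t : ℝ) : ℝ := R s s + R t t - 2 * R s t

/-- The covariance `R` has its largest variance `V` at `T`, where it decreases at rate `2d`, and the
increments near `T` are those of a Brownian motion of variance `D`. -/
structure IsLocallyBrownian (R : ℝ → ℝ → ℝ) (T V C d D : ℝ) : Prop where
  pos_T : 0 < T
  pos_V : 0 < V
  nonneg_C : 0 ≤ C
  var_end : R T T = V
  var_le : ∀ t ∈ Icc 0 T, R t t ≤ V * (t / T)
  incr_le : ∀ s ∈ Icc 0 T, ∀ t ∈ Icc 0 T, incrementVar R s t ≤ C * |s - t|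
  var_sub_le : ∀ s ∈ Icc 0 T, ∀ t ∈ Icc 0 T, |R s s - R t t| ≤ C * |s - t|
  tendsto_incr : ∀ x y, 0 ≤ x → 0 ≤ y → Tendsto
    (fun h => incrementVar R (T - x * h) (T - y * h) / h) (nhdsWithin 0 (Ioi 0)) (nhds
        (D * |x - y|))
  tendsto_var : ∀ x, 0 ≤ x → Tendsto
    (fun h => (V - R (T - x * h) (T - x * h)) / h) (nhdsWithin 0 (Ioi 0)) (nhds (2 * d * x))

namespace IsGaussianWithCov

variable {Ω : Type*} [MeasurableSpace Ω] {P : Measure Ω} {T : ℝ} {Z : ℝ → Ω → ℝ} {R : ℝ → ℝ → ℝ}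

theorem law_fintype (h : IsGaussianWithCov P T Z R) {ι : Type*} [Fintype ι] (c t : ι → ℝ)
    (ht : ∀ j, t j ∈ Icc 0 T) :
    IsCenteredGaussian P (fun ω => ∑ j, c j * Z (t j) ω) (∑ i, ∑ j, c i * c j * R (t i) (t j)) := by
  have e := (Fintype.equivFin ι).symm
  have h1 := h.law (Fintype.card ι) (c ∘ e) (t ∘ e) fun j => ht _
  convert h1 using 1
  · ext ω
    exact (Equiv.sum_comp e fun j => c j * Z (t j) ω).symm
  · rw [← Equiv.sum_comp e]
    refine Finset.sum_congr rfl fun i _ => ?_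
    rw [← Equiv.sum_comp e]
    rfl

theorem law_single (h : IsGaussianWithCov P T Z R) {t : ℝ} (ht : t ∈ Icc 0 T) :
    IsCenteredGaussian P (Z t) (R t t) := by
  have := h.law_fintype (ι := Unit) (fun _ => 1) (fun _ => t) fun _ => ht
  simpa using this

theorem isJointGaussian (h : IsGaussianWithCov P T Z R) {N : ℕ} {t : ℝ} (ht : t ∈ Icc 0 T)
    {p q : Fin N → ℝ} (hp : ∀ i, p i ∈ Icc 0 T) (hq : ∀ i, q i ∈ Icc 0 T) :
    IsJointGaussian P (Z t) (fun i ω => Z (p i) ω - Z (q i) ω) (R t t)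
      (fun i => R t (p i) - R t (q i))
      (fun i l => R (p i) (p l) - R (p i) (q l) - R (q i) (p l) + R (q i) (q l)) where
  measurable_fst := h.measurable t ht
  measurable_snd i := (h.measurable _ (hp i)).sub (h.measurable _ (hq i))
  law a c := by
    have h1 := h.law_fintype (ι := Unit ⊕ (Fin N ⊕ Fin N))
      (Sum.elim (fun _ => a) (Sum.elim c fun i => -c i)) (Sum.elim (fun _ => t) (Sum.elim p q))
      (by rintro (j | j | j); exacts [ht, hp j, hq j])
    convert h1 using 1
    · ext ω
      simp [mul_sub, Finset.sum_sub_distrib]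
      ring
    · simp only [Fintype.sum_sum_type, Sum.elim_inl, Sum.elim_inr, Finset.univ_unique,
        Finset.sum_singleton, Finset.sum_add_distrib]
      simp only [h.symm _ t, mul_sub, mul_add, Finset.sum_sub_distrib, Finset.sum_add_distrib,
        Finset.mul_sum, neg_mul, mul_neg, Finset.sum_neg_distrib, mul_assoc, mul_left_comm _ a]
      ring_nf
      simp only [← Finset.sum_mul]
      ring

end IsGaussianWithCov

/-! ### Chaining -/

theorem tsum_ofReal_exp_le {A c : ℝ} (hA : 0 ≤ A) (hc : 0 < c) :
    ∑' m : ℕ, ENNReal.ofReal (A * Real.exp (-(m * c))) ≤ ENNReal.ofReal (A * (1 + 1 / c)) := by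
  have h1 : ∀ m : ℕ, A * Real.exp (-(m * c)) = A * Real.exp (-c) ^ m := fun m => by
    rw [← Real.exp_nat_mul]
    congr 2
    ring
  have h2 : Real.exp (-c) < 1 := by
    rw [← Real.exp_zero]
    exact Real.exp_lt_exp.2 (by linarith)
  have h3 := (hasSum_geometric_of_lt_one (Real.exp_pos (-c)).le h2).mul_left A
  simp only [h1]
  rw [← ENNReal.ofReal_tsum_of_nonneg (fun m => by positivity) h3.summable, h3.tsum_eq]
  refine ENNReal.ofReal_le_ofReal (mul_le_mul_of_nonneg_left ?_ hA)
  have h4 : Real.exp (-c) ≤ 1 / (1 + c) := by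
    rw [Real.exp_neg, ← one_div]
    exact one_div_le_one_div_of_le (by positivity) (by linarith [Real.add_one_le_exp c])
  rw [inv_eq_one_div, div_le_iff₀ (by linarith)]
  have h5 : (1 + 1 / c) * (1 - 1 / (1 + c)) = 1 := by field_simp; ring
  calc 1 = (1 + 1 / c) * (1 - 1 / (1 + c)) := h5.symm
    _ ≤ (1 + 1 / c) * (1 - Real.exp (-c)) := by gcongr

namespace IsGaussianWithCov

variable {Ω : Type*} [MeasurableSpace Ω] {P : Measure Ω} {T : ℝ} {Z : ℝ → Ω → ℝ} {R : ℝ → ℝ → ℝ}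
  {V C d D : ℝ}

theorem measure_point_le (h : IsGaussianWithCov P T Z R) (hR : IsLocallyBrownian R T V C d D)
    {x v M κ : ℝ} (hx : 0 ≤ x) (hxT : x ≤ T) (hκ : 0 ≤ κ)
    (hM : 0 ≤ M) (hv : 0 < v) (hvM : 8 * M * T ≤ v) (hvC : 4 * κ ≤ v ^ 2) :
    P {ω | v - κ / v - M * x < Z (T - x) ω} ≤ ENNReal.ofReal (2 * Real.exp (2 * κ / V) *
      Real.exp (-(x * v ^ 2 / (4 * V * T))) * tailNorm V v) := by
  have hT := hR.pos_T
  have hx' : T - x ∈ Icc 0 T := ⟨by linarith, by linarith⟩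
  refine (h.law_single hx').measure_lt_le_exp hR.pos_V hT ?_ hx hxT hκ hM hv hvM hvC
  refine (hR.var_le _ hx').trans_eq ?_
  field_simp

theorem measure_link_le [IsProbabilityMeasure P] (h : IsGaussianWithCov P T Z R)
    (hR : IsLocallyBrownian R T V C d D)
    {x x' v M r y : ℝ} (hx : 0 ≤ x) (hxx : x ≤ x') (hxT : x' ≤ T) (hr : 0 < r) (hr1 : r ≤ 1)
    (hy : 1 ≤ y) (hM : 0 ≤ M) (hv : 0 < v) (hvM : 8 * M * T ≤ v) (hvM1 : M ≤ v)
    (hvC : 4 * (1 + C) ≤ v ^ 2) (hdist : x' - x ≤ r ^ 4 / (v ^ 2 * y ^ 4)) :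
    P {ω | Z (T - x) ω + M * x ≤ v - r / y / v ∧ v - r / (2 * y) / v < Z (T - x') ω + M * x'} ≤
      ENNReal.ofReal (2 * Real.exp (1 + C / 2 + 2 * (1 + C) / V) * Real.exp (-(y / (2 * r))) *
        Real.exp (-(x' * v ^ 2 / (4 * V * T))) * tailNorm V v) := by
  have hT := hR.pos_T
  have hC := hR.nonneg_C
  have hV := hR.pos_V
  have hxm : T - x ∈ Icc 0 T := ⟨by linarith, by linarith⟩
  have hxm' : T - x' ∈ Icc 0 T := ⟨by linarith, by linarith⟩
  set Δ := x' - x with hΔ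
  have hΔ0 : 0 ≤ Δ := by linarith
  set β := v * y ^ 2 / r ^ 2 with hβ
  have hβ0 : 0 ≤ β := by positivity
  have hβΔ : β ^ 2 * Δ ≤ 1 := by
    calc β ^ 2 * Δ ≤ β ^ 2 * (r ^ 4 / (v ^ 2 * y ^ 4)) := by gcongr
      _ = 1 := by rw [hβ]; field_simp
  have hβΔ1 : v * (β * Δ) ≤ 1 := by
    calc v * (β * Δ) ≤ v * (β * (r ^ 4 / (v ^ 2 * y ^ 4))) := by gcongr
      _ = r ^ 2 * (1 / y ^ 2) := by rw [hβ]; field_simp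
      _ ≤ 1 * (1 / 1) := by
        gcongr
        · exact pow_le_one₀ hr.le hr1
        · exact one_le_pow₀ hy
      _ = 1 := by norm_num
  set η := r / (2 * y) / v - M * Δ with hη
  set x₁ := v - r / (2 * y) / v - M * x' with hx₁
  have hinc : incrementVar R (T - x') (T - x) ≤ C * Δ := by
    refine (hR.incr_le _ hxm' _ hxm).trans_eq ?_
    rw [show T - x' - (T - x) = -Δ by rw [hΔ]; ring, abs_neg, abs_of_nonneg hΔ0]
  have hcov : R (T - x') (T - x') - R (T - x') (T - x) ≤ C * Δ := by
    have h2 := (abs_le.1 (hR.var_sub_le _ hxm' _ hxm)).2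
    rw [show T - x' - (T - x) = -Δ by rw [hΔ]; ring, abs_neg, abs_of_nonneg hΔ0] at h2
    simp only [incrementVar] at hinc
    linarith
  have hy2 : r / (2 * y) ≤ 1 := by
    rw [div_le_one (by positivity)]
    linarith
  rcases (h.law_single hxm').1.eq_or_lt with hs | hs
  · have hb : 0 < x₁ := by
      have e1 : r / (2 * y) / v ≤ v / 4 := by
        rw [div_le_iff₀ hv]; nlinarith
      have e2 : M * x' ≤ v / 8 := by nlinarith [mul_le_mul_of_nonneg_left hxT hM]
      rw [hx₁]
      linarith
    have h1 := (h.law_single hxm').measure_lt_le hb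
    rw [← hs] at h1
    simp only [tailNorm, Real.sqrt_zero, zero_div, zero_mul, ENNReal.ofReal_zero] at h1
    refine (measure_mono ?_).trans (h1.trans zero_le)
    rintro ω ⟨_, hω⟩
    simp only [mem_ofPred_eq, hx₁]
    linarith
  have hj := h.isJointGaussian (N := 1) hxm' (p := fun _ => T - x') (q := fun _ => T - x)
    (fun _ => hxm') fun _ => hxm
  have h1 := hj.measure_pair_le hs x₁ η hβ0
  have hsub : {ω | Z (T - x) ω + M * x ≤ v - r / y / v ∧
      v - r / (2 * y) / v < Z (T - x') ω + M * x'} ⊆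
      {ω | x₁ < Z (T - x') ω ∧ η ≤ Z (T - x') ω - Z (T - x) ω} := by
    rintro ω ⟨h2, h3⟩
    refine ⟨by rw [hx₁]; linarith, ?_⟩
    have e : r / y / v = 2 * (r / (2 * y) / v) := by field_simp
    rw [e] at h2
    rw [hη, hΔ]
    nlinarith
  refine (measure_mono hsub).trans (h1.trans ?_)
  have hpt := h.measure_point_le hR (κ := 1 + C) (by linarith) hxT (by linarith) hM hv hvM hvC
  have h2 : P {ω | x₁ - β * (R (T - x') (T - x') - R (T - x') (T - x)) < Z (T - x') ω} ≤
      P {ω | v - (1 + C) / v - M * x' < Z (T - x') ω} := by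
    refine measure_mono fun ω hω => ?_
    simp only [mem_ofPred_eq] at hω ⊢
    refine lt_of_le_of_lt ?_ hω
    have e1 : β * (R (T - x') (T - x') - R (T - x') (T - x)) ≤ C / v := by
      rw [le_div_iff₀ hv]
      calc _ ≤ β * (C * Δ) * v := by gcongr
        _ = C * (v * (β * Δ)) := by ring
        _ ≤ C * 1 := by gcongr
        _ = C := mul_one _
    have e2 : r / (2 * y) / v ≤ 1 / v := by gcongr
    rw [hx₁, add_div]
    linarith
  refine (mul_le_mul' le_rfl (h2.trans hpt)).trans ?_
  rw [← ENNReal.ofReal_mul (Real.exp_pos _).le]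
  refine ENNReal.ofReal_le_ofReal ?_
  have h3 : -(β * η) + β ^ 2 * (R (T - x') (T - x') - R (T - x') (T - x) - R (T - x) (T - x') +
      R (T - x) (T - x)) / 2 ≤ 1 + C / 2 - y / (2 * r) := by
    have e1 : R (T - x') (T - x') - R (T - x') (T - x) - R (T - x) (T - x') +
      R (T - x) (T - x) ≤ C * Δ := by
      rw [h.symm (T - x) (T - x')]
      simp only [incrementVar] at hinc
      linarith
    have e2 : β ^ 2 * (R (T - x') (T - x') - R (T - x') (T - x) - R (T - x) (T - x') +
      R (T - x) (T - x)) ≤ C := by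
      calc _ ≤ β ^ 2 * (C * Δ) := by gcongr
        _ = C * (β ^ 2 * Δ) := by ring
        _ ≤ C * 1 := by gcongr
        _ = C := mul_one _
    have e3 : β * η = y / (2 * r) - M * (β * Δ) := by
      rw [hη, mul_sub]
      congr 1
      · rw [hβ]; field_simp
      · ring
    have e4 : M * (β * Δ) ≤ 1 := le_trans (by gcongr) hβΔ1
    rw [e3]
    linarith
  have htn := tailNorm_pos hV hv
  calc _ ≤ Real.exp (1 + C / 2 - y / (2 * r)) * (2 * Real.exp (2 * (1 + C) / V) *
      Real.exp (-(x' * v ^ 2 / (4 * V * T))) * tailNorm V v) := by gcongr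
    _ = _ := by
      rw [sub_eq_add_neg, Real.exp_add, Real.exp_add (1 + C / 2)]
      ring

end IsGaussianWithCov

/-- The `m`-th point of the `j`-th level of the nested grids with mesh `r^4 / (v^2 16^j)`. -/
noncomputable def chainPoint (r v : ℝ) (j m : ℕ) : ℝ := m * (r ^ 4 / (v ^ 2 * 16 ^ j))

theorem chainPoint_nonneg (r v : ℝ) (j m : ℕ) : 0 ≤ chainPoint r v j m := by
  unfold chainPoint; positivity

theorem chainPoint_div_le {r v : ℝ} (hv : 0 < v) (j m : ℕ) :
    chainPoint r v j (m / 16) ≤ chainPoint r v (j + 1) m := by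
  have h1 : ((m / 16 : ℕ) : ℝ) ≤ m / 16 := by exact_mod_cast Nat.cast_div_le (α := ℝ)
  have h2 : chainPoint r v (j + 1) m = m / 16 * (r ^ 4 / (v ^ 2 * 16 ^ j)) := by
    unfold chainPoint
    field_simp
    ring
  rw [h2]
  unfold chainPoint
  gcongr

theorem chainPoint_sub_le {r v : ℝ} (hv : 0 < v) (j m : ℕ) :
    chainPoint r v (j + 1) m - chainPoint r v j (m / 16) ≤ r ^ 4 / (v ^ 2 * (2 ^ j) ^ 4) := by
  have h1 : (m : ℝ) / 16 - ((m / 16 : ℕ) : ℝ) ≤ 1 := by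
    have h3 : m ≤ 16 * (m / 16) + 16 := by omega
    have h4 : (m : ℝ) ≤ 16 * ((m / 16 : ℕ) : ℝ) + 16 := by exact_mod_cast h3
    linarith
  have h2 : chainPoint r v (j + 1) m = m / 16 * (r ^ 4 / (v ^ 2 * 16 ^ j)) := by
    unfold chainPoint
    field_simp
    ring
  have h5 : ((2 : ℝ) ^ j) ^ 4 = 16 ^ j := by
    rw [← pow_mul, mul_comm, pow_mul]
    norm_num
  rw [h2, h5]
  unfold chainPoint
  rw [← sub_mul]
  have : 0 ≤ r ^ 4 / (v ^ 2 * 16 ^ j) := by positivity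
  nlinarith

/-- A continuous function exceeding `v` exceeds a slightly smaller level on the coarsest grid or has
a large increment between two consecutive grids. -/
theorem exists_chainPoint_of_lt {T r v : ℝ} (hr : 0 < r) (hv : 0 < v) {f : ℝ → ℝ}
    (hf : ContinuousOn f (Icc 0 T)) {x : ℝ} (hx : x ∈ Icc 0 T) (hfx : v < f x) :
    (∃ m, chainPoint r v 0 m ≤ T ∧ v - r / v < f (chainPoint r v 0 m)) ∨
    ∃ j m, chainPoint r v (j + 1) m ≤ T ∧ f (chainPoint r v j (m / 16)) ≤ v - r / 2 ^ j / v ∧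
      v - r / (2 * 2 ^ j) / v < f (chainPoint r v (j + 1) m) := by
  by_contra! hcon
  obtain ⟨hF, hE⟩ := hcon
  have hall : ∀ j m, chainPoint r v j m ≤ T → f (chainPoint r v j m) ≤ v - r / 2 ^ j / v := by
    intro j
    induction j with
    | zero => intro m hm; simpa using hF m hm
    | succ j ih =>
      intro m hm
      have := hE j m hm (ih _ ((chainPoint_div_le hv j m).trans hm))
      rwa [pow_succ, mul_comm ((2 : ℝ) ^ j)]
  set δ : ℕ → ℝ := fun j => r ^ 4 / (v ^ 2 * 16 ^ j) with hδ
  have hδ0 : ∀ j, 0 < δ j := fun j => by positivity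
  have hδl : Tendsto δ atTop (nhds 0) := by
    have h1 : Tendsto (fun j : ℕ => r ^ 4 / v ^ 2 * ((1 / 16 : ℝ)) ^ j) atTop (nhds
        (r ^ 4 / v ^ 2 * 0)) :=
      (tendsto_pow_atTop_nhds_zero_of_lt_one (by norm_num) (by norm_num)).const_mul _
    rw [mul_zero] at h1
    refine h1.congr fun j => ?_
    rw [hδ]
    simp only [one_div, inv_pow]
    field_simp
  set m : ℕ → ℕ := fun j => ⌊x / δ j⌋₊ with hm
  have hle : ∀ j, chainPoint r v j (m j) ≤ x := fun j => by
    have := Nat.floor_le (div_nonneg hx.1 (hδ0 j).le)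
    rw [le_div_iff₀ (hδ0 j)] at this
    exact this
  have hge : ∀ j, x - δ j ≤ chainPoint r v j (m j) := fun j => by
    have := (Nat.lt_floor_add_one (x / δ j)).le
    rw [div_le_iff₀ (hδ0 j), add_mul, one_mul] at this
    have h2 : chainPoint r v j (m j) = (⌊x / δ j⌋₊ : ℝ) * δ j := rfl
    linarith
  have hlim : Tendsto (fun j => chainPoint r v j (m j)) atTop (nhdsWithin x (Icc 0 T)) := by
    refine tendsto_nhdsWithin_iff.2 ⟨?_, Eventually.of_forall fun j =>
      ⟨chainPoint_nonneg _ _ _ _, (hle j).trans hx.2⟩⟩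
    refine tendsto_of_tendsto_of_tendsto_of_le_of_le (g := fun j => x - δ j) (h := fun _ => x) ?_
      tendsto_const_nhds hge hle
    simpa using hδl.const_sub x
  have h1 : f x ≤ v := by
    refine le_of_tendsto ((hf x hx).tendsto.comp hlim) (Eventually.of_forall fun j => ?_)
    refine (hall j (m j) ((hle j).trans hx.2)).trans ?_
    have : 0 ≤ r / 2 ^ j / v := by positivity
    linarith
  linarith

theorem exp_neg_le_div_pow {x : ℝ} (hx : 0 < x) : Real.exp (-x) ≤ 120 / x ^ 5 := by
  have h := Real.pow_div_factorial_le_exp x hx.le 5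
  rw [Real.exp_neg, ← one_div, div_le_div_iff₀ (Real.exp_pos _) (by positivity)]
  rw [div_le_iff₀ (by positivity)] at h
  norm_num [Nat.factorial] at h
  linarith

theorem gridExceeds_eq_setOf {Ω : Type*} (Y : ℕ → Ω → ℝ) (N : ℕ) (a v ε : ℝ) :
    gridExceeds (N := N) (Y 0) (fun i ω => Y (i + 1) ω - Y i ω) a v ε =
      {ω | ∃ k ≤ N, v - ε / v < Y k ω + k * a} := by
  ext ω
  refine exists_congr fun k => and_congr_right fun hk => ?_
  have h1 : ∀ k ≤ N, (∑ i : Fin N, if (i : ℕ) < k then (Y (i + 1) ω - Y i ω) + a else 0) =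
      Y k ω - Y 0 ω + k * a := by
    intro k hk
    rw [Fin.sum_univ_eq_sum_range
      (fun i => if i < k then (Y (i + 1) ω - Y i ω) + a else 0) N, ← Finset.sum_filter]
    have h2 : (Finset.range N).filter (fun i => i < k) = Finset.range k := by
      ext i
      simp only [Finset.mem_filter, Finset.mem_range]
      omega
    rw [h2, Finset.sum_add_distrib, Finset.sum_range_sub (fun i => Y i ω)]
    simp
  rw [h1 k hk]
  constructor <;> intro h <;> linarith

namespace IsGaussianWithCov

variable {Ω : Type*} [MeasurableSpace Ω] {P : Measure Ω} {T : ℝ} {Z : ℝ → Ω → ℝ} {R : ℝ → ℝ → ℝ}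
  {V C d D : ℝ}

/-- The event that the `m`-th point of level `j + 1` and its parent have a large increment. -/
def linkEvent (Z : ℝ → Ω → ℝ) (T M r v : ℝ) (j m : ℕ) : Set Ω :=
  {ω | chainPoint r v (j + 1) m ≤ T ∧
    Z (T - chainPoint r v j (m / 16)) ω + M * chainPoint r v j (m / 16) ≤ v - r / 2 ^ j / v ∧
    v - r / (2 * 2 ^ j) / v <
      Z (T - chainPoint r v (j + 1) m) ω + M * chainPoint r v (j + 1) m}

theorem measure_linkEvent_le [IsProbabilityMeasure P] (h : IsGaussianWithCov P T Z R)
    (hR : IsLocallyBrownian R T V C d D) {v M r : ℝ} (hr : 0 < r) (hr1 : r ≤ 1) (hM : 0 ≤ M)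
    (hv : 0 < v) (hvM : 8 * M * T ≤ v) (hvM1 : M ≤ v) (hvC : 4 * (1 + C) ≤ v ^ 2) (j m : ℕ) :
    P (linkEvent Z T M r v j m) ≤
      ENNReal.ofReal (2 * Real.exp (1 + C / 2 + 2 * (1 + C) / V) * Real.exp (-(2 ^ j / (2 * r))) *
        tailNorm V v * Real.exp (-(m * (r ^ 4 / (64 * 16 ^ j * V * T))))) := by
  have hT := hR.pos_T
  have hV := hR.pos_V
  by_cases hmT : chainPoint r v (j + 1) m ≤ T
  · have h1 := h.measure_link_le hR (chainPoint_nonneg r v j (m / 16)) (chainPoint_div_le hv j m)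
      hmT hr hr1 (y := 2 ^ j) (one_le_pow₀ (by norm_num)) hM hv hvM hvM1 hvC
          (chainPoint_sub_le hv j m)
    have e : chainPoint r v (j + 1) m * v ^ 2 / (4 * V * T) =
        m * (r ^ 4 / (64 * 16 ^ j * V * T)) := by
      unfold chainPoint
      field_simp
      ring
    rw [e] at h1
    refine (measure_mono fun ω hω => hω.2).trans (h1.trans_eq ?_)
    congr 1
    ring
  · have : linkEvent Z T M r v j m = ∅ := by
      ext ω
      simp [linkEvent, hmT]
    rw [this, measure_empty]
    exact zero_le

theorem tsum_measure_linkEvent_le [IsProbabilityMeasure P] (h : IsGaussianWithCov P T Z R)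
    (hR : IsLocallyBrownian R T V C d D) {v M r : ℝ} (hr : 0 < r) (hr1 : r ≤ 1) (hM : 0 ≤ M)
    (hv : 0 < v) (hvM : 8 * M * T ≤ v) (hvM1 : M ≤ v) (hvC : 4 * (1 + C) ≤ v ^ 2) :
    ∑' j, ∑' m, P (linkEvent Z T M r v j m) ≤
      ENNReal.ofReal (2 * Real.exp (1 + C / 2 + 2 * (1 + C) / V) * (7680 * (1 + 64 * V * T)) * r *
        tailNorm V v) := by
  have hT := hR.pos_T
  have hV := hR.pos_V
  have htn := tailNorm_pos hV hv
  set K := 2 * Real.exp (1 + C / 2 + 2 * (1 + C) / V) with hK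
  have hK0 : 0 < K := by positivity
  have h1 : ∀ j, ∑' m, P (linkEvent Z T M r v j m) ≤
      ENNReal.ofReal (K * (3840 * (1 + 64 * V * T)) * r * tailNorm V v * (1 / 2) ^ j) := by
    intro j
    refine (ENNReal.tsum_le_tsum fun m =>
      h.measure_linkEvent_le hR hr hr1 hM hv hvM hvM1 hvC j m).trans ?_
    refine (tsum_ofReal_exp_le (by positivity) (by positivity)).trans (ENNReal.ofReal_le_ofReal ?_)
    have e1 : Real.exp (-(2 ^ j / (2 * r))) ≤ 3840 * r ^ 5 / 32 ^ j := by
      refine (exp_neg_le_div_pow (by positivity)).trans_eq ?_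
      rw [show (32 : ℝ) = 2 ^ 5 by norm_num, ← pow_mul, mul_comm 5 j, pow_mul]
      field_simp
      norm_num
    have e2 : 1 + 1 / (r ^ 4 / (64 * 16 ^ j * V * T)) ≤ 16 ^ j / r ^ 4 * (1 + 64 * V * T) := by
      rw [one_div_div, mul_add, mul_one]
      refine add_le_add ?_ (le_of_eq (by field_simp))
      rw [one_le_div (by positivity)]
      exact (pow_le_one₀ hr.le hr1).trans (one_le_pow₀ (by norm_num))
    calc _ ≤ K * (3840 * r ^ 5 / 32 ^ j) * tailNorm V v *
          (16 ^ j / r ^ 4 * (1 + 64 * V * T)) := by gcongr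
      _ = _ := by
        rw [show (32 : ℝ) = 2 * 16 by norm_num, mul_pow, one_div, inv_pow]
        field_simp
  refine (ENNReal.tsum_le_tsum h1).trans ?_
  have h2 := hasSum_geometric_two.mul_left (K * (3840 * (1 + 64 * V * T)) * r * tailNorm V v)
  rw [← ENNReal.ofReal_tsum_of_nonneg (fun j => by positivity) h2.summable, h2.tsum_eq]
  refine ENNReal.ofReal_le_ofReal (le_of_eq ?_)
  ring

/-- Discretisation of the exceedance event of a locally Brownian Gaussian process. -/
theorem measure_exists_le [IsProbabilityMeasure P] (h : IsGaussianWithCov P T Z R)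
    (hR : IsLocallyBrownian R T V C d D)
    (hcont : ∀ᵐ ω ∂P, ContinuousOn (fun t => Z t ω) (Icc 0 T)) {v M r : ℝ} (hr : 0 < r)
    (hr1 : r ≤ 1) (hM : 0 ≤ M)
    (hv : 0 < v) (hvM : 8 * M * T ≤ v) (hvM1 : M ≤ v) (hvC : 4 * (1 + C) ≤ v ^ 2) (N : ℕ) :
    P {ω | ∃ t ∈ Icc 0 T, v < Z t ω + M * (T - t)} ≤
      P {ω | ∃ k ≤ N, v - r / v < Z (max 0 (T - k * (r ^ 4 / v ^ 2))) ω + k * (M *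
          (r ^ 4 / v ^ 2))} +
      ENNReal.ofReal ((2 * Real.exp (2 / V) * Real.exp (-((N + 1) * (r ^ 4 / (4 * V * T)))) *
        (1 + 4 * V * T / r ^ 4) + 2 * Real.exp (1 + C / 2 + 2 * (1 + C) / V) *
        (7680 * (1 + 64 * V * T)) * r) * tailNorm V v) := by
  have hT := hR.pos_T
  have hV := hR.pos_V
  have hC := hR.nonneg_C
  have htn := tailNorm_pos hV hv
  set G := {ω | ∃ k ≤ N, v - r / v <
    Z (max 0 (T - k * (r ^ 4 / v ^ 2))) ω + k * (M * (r ^ 4 / v ^ 2))} with hG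
  set F : ℕ → Set Ω := fun m => {ω | chainPoint r v 0 (m + (N + 1)) ≤ T ∧
    v - r / v < Z (T - chainPoint r v 0 (m + (N + 1))) ω + M * chainPoint r v 0 (m +
        (N + 1))} with hF
  have hFm : ∑' m, P (F m) ≤ ENNReal.ofReal (2 * Real.exp (2 / V) *
      Real.exp (-((N + 1) * (r ^ 4 / (4 * V * T)))) * (1 + 4 * V * T / r ^ 4) * tailNorm V v) := by
    have h1 : ∀ m, P (F m) ≤ ENNReal.ofReal (2 * Real.exp (2 / V) *
      Real.exp (-((N + 1) * (r ^ 4 / (4 * V * T)))) * tailNorm V v *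
      Real.exp (-(m * (r ^ 4 / (4 * V * T))))) := by
      intro m
      by_cases hm : chainPoint r v 0 (m + (N + 1)) ≤ T
      · have h2 := h.measure_point_le hR (κ := 1) (chainPoint_nonneg r v 0 (m + (N + 1))) hm
          zero_le_one hM hv hvM (by linarith)
        refine (measure_mono fun ω hω => ?_).trans (h2.trans_eq ?_)
        · have h3 := hω.2
          have h4 : r / v ≤ 1 / v := by gcongr
          simp only [mem_ofPred_eq]
          linarith
        · congr 1
          have e : chainPoint r v 0 (m + (N + 1)) * v ^ 2 / (4 * V * T) =
            (N + 1) * (r ^ 4 / (4 * V * T)) + m * (r ^ 4 / (4 * V * T)) := by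
            unfold chainPoint
            push_cast
            field_simp
            ring
          rw [e, neg_add, Real.exp_add, mul_one (2 : ℝ)]
          ring
      · have : F m = ∅ := by
          ext ω
          simp [hF, hm]
        rw [this, measure_empty]
        exact zero_le
    refine (ENNReal.tsum_le_tsum h1).trans
      ((tsum_ofReal_exp_le (by positivity) (by positivity)).trans_eq ?_)
    rw [one_div_div]
    congr 1
    ring
  have hsub : {ω | ∃ t ∈ Icc 0 T, v < Z t ω + M * (T - t)} ≤ᵐ[P]
      ((G ∪ ⋃ m, F m) ∪ ⋃ j, ⋃ m, linkEvent Z T M r v j m : Set Ω) := by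
    filter_upwards [hcont] with ω hω
    rintro ⟨t, ht, hvt⟩
    have hf : ContinuousOn (fun x => Z (T - x) ω + M * x) (Icc 0 T) := by
      refine ContinuousOn.add (ContinuousOn.comp (g := fun t => Z t ω) (t := Icc 0 T) hω
          (by fun_prop)
        fun x hx => ?_) (by fun_prop)
      exact ⟨by linarith [hx.2], by linarith [hx.1]⟩
    have hx : T - t ∈ Icc 0 T := ⟨by linarith [ht.2], by linarith [ht.1]⟩
    rcases exists_chainPoint_of_lt hr hv hf hx (by simpa using hvt) with ⟨m, hm, h1⟩ | ⟨j, m, h1⟩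
    · left
      by_cases hmN : m ≤ N
      · left
        refine ⟨m, hmN, ?_⟩
        have e : chainPoint r v 0 m = m * (r ^ 4 / v ^ 2) := by simp [chainPoint]
        rw [e] at hm h1
        rw [max_eq_right (by linarith)]
        refine h1.trans_eq ?_
        ring_nf
      · right
        obtain ⟨l, rfl⟩ : ∃ l, m = l + (N + 1) := ⟨m - (N + 1), by omega⟩
        exact mem_iUnion.2 ⟨l, hm, h1⟩
    · right
      exact mem_iUnion.2 ⟨j, mem_iUnion.2 ⟨m, h1⟩⟩
  refine (measure_mono_ae hsub).trans ((measure_union_le _ _).trans ?_)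
  refine (add_le_add ((measure_union_le _ _).trans (add_le_add le_rfl
    ((measure_iUnion_le F).trans hFm))) ((measure_iUnion_le _).trans ((ENNReal.tsum_le_tsum fun j =>
      measure_iUnion_le _).trans
          (h.tsum_measure_linkEvent_le hR hr hr1 hM hv hvM hvM1 hvC)))).trans ?_
  rw [add_assoc, ← ENNReal.ofReal_add (by positivity) (by positivity), ← add_mul]

end IsGaussianWithCov

/-! ### Grids approaching the end point -/

/-- The `k`-th point of the grid on `[0,T]` with mesh `δ / v^2`, counted backwards from `T`. -/
noncomputable def gridTime (T δ v : ℝ) (k : ℕ) : ℝ := max 0 (T - k * (δ / v ^ 2))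

theorem gridTime_zero {T : ℝ} (hT : 0 ≤ T) (δ v : ℝ) : gridTime T δ v 0 = T := by
  simp [gridTime, hT]

theorem gridTime_mem {T δ : ℝ} (hT : 0 ≤ T) (hδ : 0 ≤ δ) (v : ℝ) (k : ℕ) :
    gridTime T δ v k ∈ Icc 0 T := by
  refine ⟨le_max_left _ _, max_le hT ?_⟩
  have : 0 ≤ (k : ℝ) * (δ / v ^ 2) := by positivity
  linarith

theorem sub_gridTime_le (T δ v : ℝ) (k : ℕ) : T - gridTime T δ v k ≤ k * (δ / v ^ 2) := by
  have := le_max_right 0 (T - k * (δ / v ^ 2))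
  unfold gridTime
  linarith

section Limits

variable {T V C d D δ : ℝ} {R : ℝ → ℝ → ℝ} {v : ℕ → ℝ}

theorem tendsto_mesh (hδ : 0 < δ) (hv : Tendsto v atTop atTop) :
    Tendsto (fun n => δ / v n ^ 2) atTop (nhdsWithin 0 (Ioi 0)) := by
  refine tendsto_nhdsWithin_iff.2 ⟨?_, ?_⟩
  · exact ((tendsto_pow_atTop two_ne_zero).comp hv).const_div_atTop δ
  · filter_upwards [hv.eventually_gt_atTop 0] with n hn
    exact div_pos hδ (by positivity)

theorem eventually_gridTime_eq (hT : 0 < T) (hδ : 0 < δ) (hv : Tendsto v atTop atTop) (k : ℕ) :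
    ∀ᶠ n in atTop, gridTime T δ (v n) k = T - k * (δ / v n ^ 2) := by
  have h1 : Tendsto (fun n => (k : ℝ) * (δ / v n ^ 2)) atTop (nhds (k * 0)) :=
    ((tendsto_mesh hδ hv).mono_right nhdsWithin_le_nhds).const_mul _
  rw [mul_zero] at h1
  filter_upwards [h1.eventually_lt_const hT] with n hn
  exact max_eq_right (by linarith)

namespace IsLocallyBrownian

theorem tendsto_incrementVar_gridTime (hR : IsLocallyBrownian R T V C d D) (hδ : 0 < δ)
    (hv : Tendsto v atTop atTop) (k l : ℕ) :
    Tendsto (fun n => incrementVar R (gridTime T δ (v n) k) (gridTime T δ (v n) l) * v n ^ 2) atTop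
      (nhds (D * δ * |(k : ℝ) - l|)) := by
  have h1 := ((hR.tendsto_incr k l k.cast_nonneg l.cast_nonneg).comp
      (tendsto_mesh hδ hv)).const_mul δ
  rw [show δ * (D * |(k : ℝ) - l|) = D * δ * |(k : ℝ) - l| by ring] at h1
  refine h1.congr' ?_
  filter_upwards [eventually_gridTime_eq hR.pos_T hδ hv k, eventually_gridTime_eq hR.pos_T hδ hv l,
    hv.eventually_gt_atTop 0] with n h2 h3 h4
  rw [h2, h3]
  simp only [Function.comp_apply]
  field_simp

theorem tendsto_var_gridTime (hR : IsLocallyBrownian R T V C d D) (hδ : 0 < δ)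
    (hv : Tendsto v atTop atTop) (k : ℕ) :
    Tendsto (fun n => (V - R (gridTime T δ (v n) k) (gridTime T δ (v n) k)) * v n ^ 2) atTop
      (nhds (2 * d * δ * k)) := by
  have h1 := ((hR.tendsto_var k k.cast_nonneg).comp (tendsto_mesh hδ hv)).const_mul δ
  rw [show δ * (2 * d * (k : ℝ)) = 2 * d * δ * k by ring] at h1
  refine h1.congr' ?_
  filter_upwards [eventually_gridTime_eq hR.pos_T hδ hv k, hv.eventually_gt_atTop 0] with n h2 h4
  rw [h2]
  simp only [Function.comp_apply]
  field_simp

end IsLocallyBrownian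

variable {Ω : Type*} [MeasurableSpace Ω] {P : Measure Ω} {Z : ℝ → Ω → ℝ}

theorem IsGaussianWithCov.isWalkLimit (h : IsGaussianWithCov P T Z R)
    (hR : IsLocallyBrownian R T V C d D) (hD : 0 < D) (hδ : 0 < δ) (hv : Tendsto v atTop atTop)
    (M : ℝ) (N : ℕ) {q : ℝ≥0} (hq : (q : ℝ) = D * δ / V ^ 2) :
    IsWalkLimit (N := N) P (Z T)
      (fun n i ω => Z (gridTime T δ (v n) (i + 1)) ω - Z (gridTime T δ (v n) i) ω) V
      (fun n i => R T (gridTime T δ (v n) (i + 1)) - R T (gridTime T δ (v n) i))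
      (fun n i l => R (gridTime T δ (v n) (i + 1)) (gridTime T δ (v n) (l + 1)) -
        R (gridTime T δ (v n) (i + 1)) (gridTime T δ (v n) l) -
        R (gridTime T δ (v n) i) (gridTime T δ (v n) (l + 1)) +
        R (gridTime T δ (v n) i) (gridTime T δ (v n) l)) v
      (fun n => M * (δ / v n ^ 2)) q (1 + 2 * d / D) := by
  have hT := hR.pos_T
  have hV := hR.pos_V
  have hmem := gridTime_mem hT.le hδ.le
  refine ⟨hV, fun n => ?_, hv, fun i => ?_, fun i l => ?_, ?_⟩
  · have := h.isJointGaussian (N := N) ⟨hT.le, le_rfl⟩ (p := fun i => gridTime T δ (v n) (i + 1))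
      (q := fun i => gridTime T δ (v n) i) (fun i => hmem _ _) fun i => hmem _ _
    rwa [hR.var_end] at this
  · have h1 := ((hR.tendsto_var_gridTime hδ hv i).sub (hR.tendsto_var_gridTime hδ hv (i + 1))).sub
      ((hR.tendsto_incrementVar_gridTime hδ hv 0 (i + 1)).sub
        (hR.tendsto_incrementVar_gridTime hδ hv 0 i))
    have h2 := h1.div_const (2 * V ^ 2)
    convert h2 using 1
    · ext n
      rw [gridTime_zero hT.le]
      simp only [incrementVar, hR.var_end]
      field_simp
      ring
    · congr 1
      rw [hq, abs_sub_comm, abs_sub_comm _ ((i : ℕ) : ℝ), Nat.cast_zero, sub_zero, sub_zero,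
        Nat.abs_cast, Nat.abs_cast]
      push_cast
      field_simp
      ring
  · have h1 := ((hR.tendsto_incrementVar_gridTime hδ hv (i + 1) l).add
      (hR.tendsto_incrementVar_gridTime hδ hv i (l + 1))).sub
      ((hR.tendsto_incrementVar_gridTime hδ hv (i + 1) (l + 1)).add
        (hR.tendsto_incrementVar_gridTime hδ hv i l))
    have h2 := h1.div_const (2 * V ^ 2)
    convert h2 using 1
    · ext n
      simp only [incrementVar]
      field_simp
      ring
    · congr 1
      push_cast
      rcases lt_trichotomy (i : ℕ) l with hil | hil | hil
      · rw [if_neg (by rintro rfl; omega)]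
        have : (i : ℝ) + 1 ≤ (l : ℕ) := by exact_mod_cast hil
        rw [abs_of_nonpos (by linarith), abs_of_nonpos (by linarith), abs_of_nonpos (by linarith),
          abs_of_nonpos (by linarith)]
        ring
      · have : i = l := Fin.ext hil
        subst this
        rw [if_pos rfl, hq]
        simp
        field_simp
        ring
      · rw [if_neg (by rintro rfl; omega)]
        have : (l : ℝ) + 1 ≤ (i : ℕ) := by exact_mod_cast hil
        rw [abs_of_nonneg (by linarith), abs_of_nonneg (by linarith), abs_of_nonneg (by linarith),
          abs_of_nonneg (by linarith)]
        ring
  · have h1 := hv.const_div_atTop (M * δ)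
    refine h1.congr' ?_
    filter_upwards [hv.eventually_gt_atTop 0] with n hn
    field_simp

theorem gridExceeds_gridTime_eq (hT : 0 ≤ T) (Z : ℝ → Ω → ℝ) (N : ℕ) (δ v a ε : ℝ) :
    gridExceeds (N := N) (Z T)
      (fun i ω => Z (gridTime T δ v (i + 1)) ω - Z (gridTime T δ v i) ω) a v ε =
      {ω | ∃ k ≤ N, v - ε / v < Z (gridTime T δ v k) ω + k * a} := by
  have := gridExceeds_eq_setOf (fun k => Z (gridTime T δ v k)) N a v ε
  rwa [gridTime_zero hT] at this

end Limits

section Limits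

variable {T V C d D : ℝ} {R : ℝ → ℝ → ℝ} {v : ℕ → ℝ}
variable {Ω : Type*} [MeasurableSpace Ω] {P : Measure Ω} {Z : ℝ → Ω → ℝ}

theorem ENNReal.ofReal_mul_div_ofReal {a b : ℝ} (ha : 0 ≤ a) (hb : 0 < b) :
    ENNReal.ofReal (a * b) / ENNReal.ofReal b = ENNReal.ofReal a := by
  rw [ENNReal.ofReal_mul ha, ENNReal.mul_div_cancel_right (by simpa using hb) ENNReal.ofReal_ne_top]

namespace IsGaussianWithCov

theorem limsup_exists_le_aux [IsProbabilityMeasure P] (h : IsGaussianWithCov P T Z R)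
    (hR : IsLocallyBrownian R T V C d D) (hD : 0 < D) (hd : 0 < d)
    (hcont : ∀ᵐ ω ∂P, ContinuousOn (fun t => Z t ω) (Icc 0 T)) {M r : ℝ} (hM : 0 ≤ M) (hr : 0 < r)
    (hr1 : r ≤ 1) (hv : Tendsto v atTop atTop) (N : ℕ) :
    limsup (fun n => P {ω | ∃ t ∈ Icc 0 T, v n < Z t ω + M * (T - t)} /
        ENNReal.ofReal (tailNorm V (v n))) atTop ≤
      ENNReal.ofReal (Real.exp (r / V + r) * (1 + D / (2 * d))) +
      ENNReal.ofReal (2 * Real.exp (2 / V) * Real.exp (-((N + 1) * (r ^ 4 / (4 * V * T)))) *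
        (1 + 4 * V * T / r ^ 4) + 2 * Real.exp (1 + C / 2 + 2 * (1 + C) / V) *
        (7680 * (1 + 64 * V * T)) * r) := by
  have hT := hR.pos_T
  have hV := hR.pos_V
  set E := 2 * Real.exp (2 / V) * Real.exp (-((N + 1) * (r ^ 4 / (4 * V * T)))) *
        (1 + 4 * V * T / r ^ 4) + 2 * Real.exp (1 + C / 2 + 2 * (1 + C) / V) *
        (7680 * (1 + 64 * V * T)) * r with hE
  have hE0 : 0 ≤ E := by positivity
  have hq : ((D * r ^ 4 / V ^ 2).toNNReal : ℝ) = D * r ^ 4 / V ^ 2 :=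
    Real.coe_toNNReal _ (by positivity)
  have hw := h.isWalkLimit hR hD (δ := r ^ 4) (by positivity) hv M N hq
  have h1 := hw.limsup_gridExceeds_le r hr
  have hθ : 1 < 1 + 2 * d / D := by
    have : 0 < 2 * d / D := by positivity
    linarith
  have h2 := h1.trans (lintegral_exp_mul_walkProb_le _ hθ _ _ _)
  rw [show 1 / (1 + 2 * d / D - 1) = D / (2 * d) by field_simp; ring] at h2
  refine le_trans ?_ (add_le_add h2 le_rfl)
  rw [← limsup_add_const _ _ _ (by isBoundedDefault) (by isBoundedDefault)]
  refine limsup_le_limsup ?_ (by isBoundedDefault) (by isBoundedDefault)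
  filter_upwards [hv.eventually_gt_atTop 0, hv.eventually_ge_atTop (8 * M * T),
    hv.eventually_ge_atTop M,
    ((tendsto_pow_atTop two_ne_zero).comp hv).eventually_ge_atTop (4 * (1 + C))] with n e1 e2 e3 e4
  have h3 := h.measure_exists_le hR hcont hr hr1 hM e1 e2 e3 e4 N
  have htn := tailNorm_pos hV e1
  rw [gridExceeds_gridTime_eq hT.le, ← ENNReal.ofReal_mul_div_ofReal hE0 htn, ← ENNReal.add_div]
  exact ENNReal.div_le_div_right h3 _

theorem limsup_exists_le [IsProbabilityMeasure P] (h : IsGaussianWithCov P T Z R)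
    (hR : IsLocallyBrownian R T V C d D) (hD : 0 < D) (hd : 0 < d)
    (hcont : ∀ᵐ ω ∂P, ContinuousOn (fun t => Z t ω) (Icc 0 T)) {M : ℝ} (hM : 0 ≤ M)
    (hv : Tendsto v atTop atTop) :
    limsup (fun n => P {ω | ∃ t ∈ Icc 0 T, v n < Z t ω + M * (T - t)} /
        ENNReal.ofReal (tailNorm V (v n))) atTop ≤ ENNReal.ofReal (1 + D / (2 * d)) := by
  have hT := hR.pos_T
  have hV := hR.pos_V
  set K := 2 * Real.exp (1 + C / 2 + 2 * (1 + C) / V) * (7680 * (1 + 64 * V * T)) with hK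
  have h1 : ∀ r, 0 < r → r ≤ 1 → limsup (fun n => P {ω | ∃ t ∈ Icc 0 T, v n < Z t ω + M * (T - t)} /
        ENNReal.ofReal (tailNorm V (v n))) atTop ≤
      ENNReal.ofReal (Real.exp (r / V + r) * (1 + D / (2 * d))) + ENNReal.ofReal (K * r) := by
    intro r hr hr1
    refine ge_of_tendsto' (x := (atTop : Filter ℕ)) ?_ fun N =>
      h.limsup_exists_le_aux hR hD hd hcont hM hr hr1 hv N
    refine Tendsto.add tendsto_const_nhds (ENNReal.tendsto_ofReal ?_)
    have e1 : Tendsto (fun N : ℕ => ((N : ℝ) + 1) * (r ^ 4 / (4 * V * T))) atTop atTop :=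
      (tendsto_atTop_add_const_right _ _ tendsto_natCast_atTop_atTop).atTop_mul_const
          (by positivity)
    have e2 := (((Real.tendsto_exp_neg_atTop_nhds_zero.comp e1).const_mul
      (2 * Real.exp (2 / V))).mul_const (1 + 4 * V * T / r ^ 4)).add_const (K * r)
    rw [mul_zero, zero_mul, zero_add] at e2
    exact e2
  have h2 : Tendsto (fun r : ℝ => ENNReal.ofReal (Real.exp (r / V + r) * (1 + D / (2 * d))) +
      ENNReal.ofReal (K * r)) (nhdsWithin 0 (Ioi 0)) (nhds (ENNReal.ofReal (1 + D / (2 * d)))) := by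
    have hc : Continuous fun r : ℝ => ENNReal.ofReal (Real.exp (r / V + r) * (1 + D / (2 * d))) +
      ENNReal.ofReal (K * r) :=
      (ENNReal.continuous_ofReal.comp (by fun_prop)).add (ENNReal.continuous_ofReal.comp
          (by fun_prop))
    have := (hc.tendsto 0).mono_left (nhdsWithin_le_nhds (s := Ioi 0))
    simpa using this
  refine ge_of_tendsto h2 ?_
  filter_upwards [Ioc_mem_nhdsGT (zero_lt_one' ℝ)] with r hr using h1 r hr.1 hr.2

theorem le_liminf_exists [IsProbabilityMeasure P] (h : IsGaussianWithCov P T Z R)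
    (hR : IsLocallyBrownian R T V C d D) (hD : 0 < D) (hd : 0 < d) {M : ℝ} (hM : 0 ≤ M)
    (hv : Tendsto v atTop atTop) :
    ENNReal.ofReal (1 + D / (2 * d)) ≤
      liminf (fun n => P {ω | ∃ t ∈ Icc 0 T, v n < Z t ω - M * (T - t)} /
        ENNReal.ofReal (tailNorm V (v n))) atTop := by
  have hT := hR.pos_T
  have hV := hR.pos_V
  have hθ : 1 < 1 + 2 * d / D := by
    have : 0 < 2 * d / D := by positivity
    linarith
  have h1 := le_liminf_lintegral_exp_mul_walkProb _ hθ (r := 1) one_ne_zero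
  rw [show 1 / (1 + 2 * d / D - 1) = D / (2 * d) by field_simp; ring] at h1
  refine h1.trans ?_
  refine (liminf_le_liminf (v := fun _ => _) (Eventually.of_forall fun k => ?_)
    (by isBoundedDefault) (by isBoundedDefault)).trans (liminf_const _).le
  set δ : ℝ := V ^ 2 / D / (k + 1) ^ 2 with hδ
  have hδ0 : 0 < δ := by positivity
  have hq : ((1 / (k + 1) ^ 2 : ℝ≥0) : ℝ) = D * δ / V ^ 2 := by
    rw [hδ]
    push_cast
    field_simp
  have hw := h.isWalkLimit hR hD hδ0 hv (-M) ((k + 1) ^ 4) hq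
  refine hw.le_liminf_gridExceeds.trans (liminf_le_liminf (Eventually.of_forall fun n =>
    ENNReal.div_le_div_right (measure_mono fun ω hω => ?_) _)
    (by isBoundedDefault) (by isBoundedDefault))
  rw [gridExceeds_gridTime_eq hT.le] at hω
  obtain ⟨m, _, hm⟩ := hω
  refine ⟨_, gridTime_mem hT.le hδ0.le (v n) m, ?_⟩
  have h2 := mul_le_mul_of_nonneg_left (sub_gridTime_le T δ (v n) m) hM
  rw [zero_div, sub_zero] at hm
  linarith

/-- Exact asymptotics of the exceedance probability of a locally Brownian Gaussian process. -/
theorem tendsto_measure_exists [IsProbabilityMeasure P] (h : IsGaussianWithCov P T Z R)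
    (hR : IsLocallyBrownian R T V C d D) (hD : 0 < D) (hd : 0 < d)
    (hcont : ∀ᵐ ω ∂P, ContinuousOn (fun t => Z t ω) (Icc 0 T)) {M : ℝ} {g : ℝ → ℝ}
    (hg : ∀ t ∈ Icc 0 T, |g T - g t| ≤ M * (T - t)) (hv : Tendsto v atTop atTop) :
    Tendsto (fun n => P {ω | ∃ t ∈ Icc 0 T, v n < Z t ω + (g T - g t)} /
        ENNReal.ofReal (tailNorm V (v n))) atTop (nhds (ENNReal.ofReal (1 + D / (2 * d)))) := by
  have hT := hR.pos_T
  have hM : 0 ≤ M := by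
    have := (abs_nonneg _).trans (hg 0 ⟨le_rfl, hT.le⟩)
    rw [sub_zero] at this
    exact nonneg_of_mul_nonneg_left this hT
  refine tendsto_of_le_liminf_of_limsup_le ?_ ?_
  · refine (h.le_liminf_exists hR hD hd hM hv).trans (liminf_le_liminf
      (Eventually.of_forall fun n =>
      ENNReal.div_le_div_right (measure_mono ?_) _) (by isBoundedDefault) (by isBoundedDefault))
    rintro ω ⟨t, ht, hω⟩
    exact ⟨t, ht, by linarith [(abs_le.1 (hg t ht)).1]⟩
  · refine (limsup_le_limsup (Eventually.of_forall fun n =>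
      ENNReal.div_le_div_right (measure_mono ?_) _) (by isBoundedDefault)
      (by isBoundedDefault)).trans (h.limsup_exists_le hR hD hd hcont hM hv)
    rintro ω ⟨t, ht, hω⟩
    exact ⟨t, ht, by linarith [(abs_le.1 (hg t ht)).2]⟩

end IsGaussianWithCov

/-- Mills ratio of a Gaussian distribution. -/
theorem tendsto_gaussianReal_Ioi_div_tailNorm (hV : 0 < V) (hv : Tendsto v atTop atTop) :
    Tendsto (fun n => gaussianReal 0 V.toNNReal (Ioi (v n)) / ENNReal.ofReal (tailNorm V
        (v n))) atTop
      (nhds 1) := by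
  have hone : ∫⁻ y in Iio (0 : ℝ), ENNReal.ofReal (Real.exp y) = 1 := by
    have h2 := lintegral_exp_Iic 0
    rwa [Real.exp_zero, ENNReal.ofReal_one, setLIntegral_congr Iio_ae_eq_Iic.symm] at h2
  have hint : ∀ᶠ n in atTop, gaussianReal 0 V.toNNReal (Ioi (v n)) /
      ENNReal.ofReal (tailNorm V (v n)) = ∫⁻ y in Iio 0, tailDensity V (v n) y := by
    filter_upwards [hv.eventually_gt_atTop 0] with n hn
    have h1 : gaussianReal 0 V.toNNReal (Ioi (v n)) =
        (gaussianReal 0 V.toNNReal).map (fun x => v n * (v n - x) / V) (Iio 0) := by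
      rw [Measure.map_apply (by fun_prop) measurableSet_Iio]
      congr 1
      ext x
      simp only [mem_Ioi, mem_preimage, mem_Iio]
      rw [div_lt_iff₀ hV, zero_mul, mul_neg_iff]
      constructor
      · exact fun hx => Or.inl ⟨hn, by linarith⟩
      · rintro (h | h)
        · linarith [h.2]
        · linarith [h.1]
    rw [h1, map_gaussianReal_rescale hV hn, withDensity_apply _ measurableSet_Iio,
      lintegral_const_mul _ (measurable_tailDensity V (v n)), mul_comm,
      ENNReal.mul_div_cancel_right (by simpa using tailNorm_pos hV hn) ENNReal.ofReal_ne_top]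
  refine (tendsto_congr' hint).2 (tendsto_of_le_liminf_of_limsup_le ?_ ?_)
  · rw [← hone]
    refine le_trans (lintegral_mono fun y => ?_)
      (lintegral_liminf_le fun n => measurable_tailDensity V (v n))
    refine (Tendsto.liminf_eq ?_).ge
    have h1 : Tendsto (fun n => y - y ^ 2 * V / (2 * v n ^ 2)) atTop (nhds (y - 0)) :=
      (Tendsto.const_div_atTop
        (((tendsto_pow_atTop two_ne_zero).comp hv).const_mul_atTop two_pos) _).const_sub y
    rw [sub_zero] at h1
    exact ENNReal.tendsto_ofReal ((Real.continuous_exp.tendsto y).comp h1)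
  · refine limsup_le_of_le (by isBoundedDefault) (Eventually.of_forall fun n => ?_)
    rw [← hone]
    refine lintegral_mono fun y => ENNReal.ofReal_le_ofReal (Real.exp_le_exp.2 ?_)
    have : 0 ≤ y ^ 2 * V / (2 * v n ^ 2) := by positivity
    linarith

end Limits

/-! ### Bifractional Brownian motion -/

/-- The covariance of bifractional Brownian motion. -/
noncomputable def bifractionalCov (K H s t : ℝ) : ℝ :=
  (2 : ℝ) ^ (-K) * ((t ^ (2 * H) + s ^ (2 * H)) ^ K - |t - s| ^ (2 * K * H))

theorem bifractionalCov_symm (K H s t : ℝ) : bifractionalCov K H s t = bifractionalCov K H t s := by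
  unfold bifractionalCov
  rw [add_comm, abs_sub_comm]

section Bifractional

variable {K H : ℝ}

theorem bifractionalCov_self (hK : 0 < K) (hH : 0 < H) {t : ℝ} (ht : 0 ≤ t) :
    bifractionalCov K H t t = t ^ (2 * K * H) := by
  have h1 : 0 ≤ t ^ (2 * H) := Real.rpow_nonneg ht _
  unfold bifractionalCov
  rw [sub_self, abs_zero, Real.zero_rpow (by positivity), sub_zero, ← two_mul,
    Real.mul_rpow two_pos.le h1, ← mul_assoc, ← Real.rpow_add two_pos, neg_add_cancel,
    Real.rpow_zero, one_mul, ← Real.rpow_mul ht]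
  congr 1
  ring

theorem incrementVar_bifractionalCov (hK : 0 < K) (hH : 0 < H) {s t : ℝ} (hs : 0 ≤ s) (ht : 0 ≤ t) :
    incrementVar (bifractionalCov K H) s t =
      (s ^ (2 * K * H) + t ^ (2 * K * H) -
        (2 : ℝ) ^ (1 - K) * (t ^ (2 * H) + s ^ (2 * H)) ^ K) +
      (2 : ℝ) ^ (1 - K) * |t - s| ^ (2 * K * H) := by
  have h1 : (2 : ℝ) ^ (1 - K) = 2 * (2 : ℝ) ^ (-K) := by
    rw [sub_eq_add_neg, Real.rpow_add two_pos, Real.rpow_one]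
  unfold incrementVar
  rw [bifractionalCov_self hK hH hs, bifractionalCov_self hK hH ht, h1]
  unfold bifractionalCov
  ring

theorem incrementVar_bifractionalCov_le (hK : K ∈ Ioc (0 : ℝ) 1) (hH : 0 < H) {s t : ℝ}
    (hs : 0 ≤ s) (ht : 0 ≤ t) :
    incrementVar (bifractionalCov K H) s t ≤ (2 : ℝ) ^ (1 - K) * |t - s| ^ (2 * K * H) := by
  rw [incrementVar_bifractionalCov hK.1 hH hs ht]
  have hs' : 0 ≤ s ^ (2 * H) := Real.rpow_nonneg hs _
  have ht' : 0 ≤ t ^ (2 * H) := Real.rpow_nonneg ht _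
  have h1 := (Real.concaveOn_rpow hK.1.le hK.2).2 (mem_Ici.2 hs') (mem_Ici.2 ht')
    (by norm_num : (0 : ℝ) ≤ 1 / 2) (by norm_num : (0 : ℝ) ≤ 1 / 2) (by norm_num)
  simp only [smul_eq_mul] at h1
  rw [← mul_add, ← mul_add, Real.mul_rpow (by norm_num) (by positivity), ← Real.rpow_mul hs,
    ← Real.rpow_mul ht, add_comm (s ^ (2 * H))] at h1
  have h2 : (2 : ℝ) ^ (1 - K) = 2 * (1 / 2 : ℝ) ^ K := by
    rw [Real.rpow_sub two_pos, Real.rpow_one, one_div, Real.inv_rpow two_pos.le, div_eq_mul_inv]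
  rw [show 2 * H * K = 2 * K * H by ring] at h1
  rw [h2] at *
  nlinarith

/-- The rate `2^{1-K}` at which the increments of bifractional Brownian motion look Brownian. -/
noncomputable def bifractionalRate (K H : ℝ) : ℝ := if K * H = 1 / 2 then (2 : ℝ) ^ (1 - K) else 0

theorem tendsto_incrementVar_bifractionalCov (hK : 0 < K) (hH : 0 < H) (hKH : 1 / 2 ≤ K * H)
    {T x y : ℝ} (hT : 0 < T) :
    Tendsto (fun h => incrementVar (bifractionalCov K H) (T - x * h) (T - y * h) / h)
      (nhdsWithin 0 (Ioi 0)) (nhds (bifractionalRate K H * |x - y|)) := by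
  have hline : ∀ x : ℝ, HasDerivAt (fun h : ℝ => T - x * h) (-x) 0 := fun x => by
    simpa using ((hasDerivAt_id (0 : ℝ)).const_mul x).const_sub T
  have hpow : ∀ x p : ℝ, HasDerivAt (fun h : ℝ => (T - x * h) ^ p) (-x * p * T ^ (p - 1)) 0 :=
    fun x p => by simpa using (hline x).rpow_const (p := p) (Or.inl (by simpa using hT.ne'))
  have hTH : 0 < T ^ (2 * H) := Real.rpow_pos_of_pos hT _
  have hφ : HasDerivAt (fun h : ℝ => (T - x * h) ^ (2 * K * H) + (T - y * h) ^ (2 * K * H) -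
      (2 : ℝ) ^ (1 - K) * ((T - y * h) ^ (2 * H) + (T - x * h) ^ (2 * H)) ^ K) 0 0 := by
    have h1 := ((hpow x (2 * K * H)).add (hpow y (2 * K * H))).sub
      ((((hpow y (2 * H)).add (hpow x (2 * H))).rpow_const (p := K)
        (Or.inl (by simp only [Pi.add_apply, mul_zero, sub_zero]; positivity))).const_mul
            ((2 : ℝ) ^ (1 - K)))
    refine h1.congr_deriv ?_
    simp only [Pi.add_apply, mul_zero, sub_zero]
    have e1 : (T ^ (2 * H) + T ^ (2 * H)) ^ (K - 1) = 2 ^ (K - 1) * T ^ (2 * H * (K - 1)) := by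
      rw [← two_mul, Real.mul_rpow two_pos.le hTH.le, Real.rpow_mul hT.le (2 * H) (K - 1)]
    have e2 : (2 : ℝ) ^ (1 - K) * 2 ^ (K - 1) = 1 := by
      rw [← Real.rpow_add two_pos]; simp
    have e3 : T ^ (2 * H - 1) * T ^ (2 * H * (K - 1)) = T ^ (2 * K * H - 1) := by
      rw [← Real.rpow_add hT]; congr 1; ring
    rw [e1, ← e3]
    linear_combination (y + x) * (2 * H) * K * T ^ (2 * H - 1) * T ^ (2 * H * (K - 1)) * e2
  have hφ0 : Tendsto (fun h : ℝ => ((T - x * h) ^ (2 * K * H) + (T - y * h) ^ (2 * K * H) -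
      (2 : ℝ) ^ (1 - K) * ((T - y * h) ^ (2 * H) + (T - x * h) ^ (2 * H)) ^ K) / h)
      (nhdsWithin 0 (Ioi 0)) (nhds 0) := by
    have h1 := hφ.tendsto_slope_zero_right
    refine h1.congr fun h => ?_
    have e0 : T ^ (2 * K * H) + T ^ (2 * K * H) -
        (2 : ℝ) ^ (1 - K) * (T ^ (2 * H) + T ^ (2 * H)) ^ K = 0 := by
      rw [← two_mul (T ^ (2 * H)), Real.mul_rpow two_pos.le hTH.le, ← mul_assoc,
        ← Real.rpow_add two_pos, ← Real.rpow_mul hT.le, show 2 * H * K = 2 * K * H by ring]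
      simp
      ring
    simp only [zero_add, mul_zero, sub_zero, e0, smul_eq_mul]
    ring
  have hψ : Tendsto (fun h : ℝ => (2 : ℝ) ^ (1 - K) * |x - y| ^ (2 * K * H) * h ^ (2 * K * H - 1))
      (nhdsWithin 0 (Ioi 0)) (nhds (bifractionalRate K H * |x - y|)) := by
    unfold bifractionalRate
    split_ifs with h
    · have e : 2 * K * H = 1 := by linarith
      rw [e]
      simp
    · have hp : 0 < 2 * K * H - 1 := by
        have := lt_of_le_of_ne hKH (Ne.symm h)
        linarith
      have h1 := (((Real.continuousAt_rpow_const (0 : ℝ) _ (Or.inr hp.le)).tendsto.mono_left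
        (nhdsWithin_le_nhds (s := Ioi 0))).const_mul ((2 : ℝ) ^ (1 - K) * |x - y| ^ (2 * K * H)))
      rw [Real.zero_rpow hp.ne', mul_zero] at h1
      rwa [zero_mul]
  have h1 := hφ0.add hψ
  rw [zero_add] at h1
  refine h1.congr' ?_
  have hev : ∀ x : ℝ, ∀ᶠ h in nhdsWithin (0 : ℝ) (Ioi 0), 0 ≤ T - x * h := fun x => by
    have := ((hline x).continuousAt.tendsto.mono_left (nhdsWithin_le_nhds (s := Ioi 0)))
    rw [mul_zero, sub_zero] at this
    exact (this.eventually_const_lt hT).mono fun _ h => h.le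
  filter_upwards [self_mem_nhdsWithin, hev x, hev y] with h hh hx hy
  have hh : 0 < h := hh
  rw [incrementVar_bifractionalCov hK hH hx hy,
    show T - y * h - (T - x * h) = h * (x - y) by ring, abs_mul, abs_of_pos hh,
    Real.mul_rpow hh.le (abs_nonneg _), Real.rpow_sub hh, Real.rpow_one]
  ring

theorem isLocallyBrownian_bifractionalCov (hK : K ∈ Ioc (0 : ℝ) 1) (hH : 0 < H)
    (hKH : 1 / 2 ≤ K * H) {T : ℝ} (hT : 0 < T) :
    IsLocallyBrownian (bifractionalCov K H) T (T ^ (2 * K * H))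
      ((2 : ℝ) ^ (1 - K) * T ^ (2 * K * H - 1) + 2 * K * H * T ^ (2 * K * H - 1))
      (K * H * T ^ (2 * K * H) / T) (bifractionalRate K H) := by
  have hK0 := hK.1
  set p := 2 * K * H with hp
  have hp1 : 1 ≤ p := by rw [hp]; linarith
  have hTp : 0 < T ^ (p - 1) := Real.rpow_pos_of_pos hT _
  have hTT : T ^ p = T ^ (p - 1) * T := by
    rw [← Real.rpow_add_one hT.ne']
    congr 1
    ring
  have hsub : ∀ s ∈ Icc 0 T, ∀ t ∈ Icc 0 T, s ≤ t → t ^ p - s ^ p ≤ p * T ^ (p - 1) * (t - s) := by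
    intro s hs t ht hst
    rcases ht.1.eq_or_lt with h0 | h0
    · have : s = t := le_antisymm hst (h0 ▸ hs.1)
      simp [this]
    have h1 := one_add_mul_self_le_rpow_one_add (s := s / t - 1)
      (by have := div_nonneg hs.1 ht.1; linarith) hp1
    rw [add_sub_cancel, Real.div_rpow hs.1 ht.1, le_div_iff₀ (Real.rpow_pos_of_pos h0 _)] at h1
    have h2 : t ^ p = t ^ (p - 1) * t := by
      rw [← Real.rpow_add_one h0.ne']
      congr 1
      ring
    have h3 : t ^ (p - 1) ≤ T ^ (p - 1) := Real.rpow_le_rpow ht.1 ht.2 (by linarith)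
    have h4 : (1 + p * (s / t - 1)) * t ^ p = t ^ p - p * t ^ (p - 1) * (t - s) := by
      rw [h2]
      field_simp
      ring
    have h5 : p * t ^ (p - 1) * (t - s) ≤ p * T ^ (p - 1) * (t - s) := by
      have := sub_nonneg.2 hst
      gcongr
    linarith
  refine ⟨hT, Real.rpow_pos_of_pos hT _, by positivity, bifractionalCov_self hK.1 hH hT.le,
    fun t ht => ?_, fun s hs t ht => ?_, fun s hs t ht => ?_, fun x y _ _ =>
    tendsto_incrementVar_bifractionalCov hK.1 hH hKH hT, fun x hx => ?_⟩
  · rw [bifractionalCov_self hK.1 hH ht.1]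
    have h1 : t ^ p = T ^ p * (t / T) ^ p := by
      rw [Real.div_rpow ht.1 hT.le]
      field_simp
    have h2 : (t / T) ^ p ≤ (t / T) ^ (1 : ℝ) :=
      Real.rpow_le_rpow_of_exponent_ge_of_imp (div_nonneg ht.1 hT.le) ((div_le_one hT).2 ht.2) hp1
        (by intros; linarith)
    rw [Real.rpow_one] at h2
    exact h1.trans_le (by gcongr)
  · refine (incrementVar_bifractionalCov_le hK hH hs.1 ht.1).trans ?_
    rw [abs_sub_comm]
    have h1 : |s - t| ≤ T := abs_le.2 ⟨by linarith [hs.1, ht.2], by linarith [hs.2, ht.1]⟩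
    have h2 : |s - t| ^ p ≤ T ^ (p - 1) * |s - t| := by
      rcases (abs_nonneg (s - t)).eq_or_lt with h0 | h0
      · rw [← h0, mul_zero, Real.zero_rpow (by linarith)]
      · have : |s - t| ^ p = |s - t| ^ (p - 1) * |s - t| := by
          rw [← Real.rpow_add_one h0.ne']
          congr 1
          ring
        rw [this]
        gcongr
    have h3 : 0 ≤ p * T ^ (p - 1) * |s - t| := by positivity
    have h4 : (2 : ℝ) ^ (1 - K) * |s - t| ^ p ≤ (2 : ℝ) ^ (1 - K) * (T ^ (p - 1) * |s - t|) := by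
      gcongr
    linarith
  · rw [bifractionalCov_self hK.1 hH hs.1, bifractionalCov_self hK.1 hH ht.1]
    have h3 : 0 ≤ (2 : ℝ) ^ (1 - K) * T ^ (p - 1) * |s - t| := by positivity
    rw [add_mul]
    refine le_trans ?_ (le_add_of_nonneg_left h3)
    rcases le_total s t with hst | hst
    · rw [abs_sub_comm, abs_sub_comm s, abs_of_nonneg (sub_nonneg.2 hst), abs_of_nonneg
        (sub_nonneg.2 (Real.rpow_le_rpow hs.1 hst (by linarith)))]
      exact hsub s hs t ht hst
    · rw [abs_of_nonneg (sub_nonneg.2 hst), abs_of_nonneg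
        (sub_nonneg.2 (Real.rpow_le_rpow ht.1 hst (by linarith)))]
      exact hsub t ht s hs hst
  · have hline : HasDerivAt (fun h : ℝ => T - x * h) (-x) 0 := by
      simpa using ((hasDerivAt_id (0 : ℝ)).const_mul x).const_sub T
    have h1 := (hline.rpow_const (p := p) (Or.inl (by simpa using hT.ne'))).const_sub (T ^ p)
    have h2 := h1.tendsto_slope_zero_right
    simp only [mul_zero, sub_zero, zero_add, sub_self, smul_eq_mul] at h2
    have e : -(-x * p * T ^ (p - 1)) = 2 * (K * H * T ^ p / T) * x := by
      rw [hTT, hp]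
      field_simp
    rw [e] at h2
    refine h2.congr' ?_
    have hev : ∀ᶠ h in nhdsWithin (0 : ℝ) (Ioi 0), 0 ≤ T - x * h := by
      have := (hline.continuousAt.tendsto.mono_left (nhdsWithin_le_nhds (s := Ioi 0)))
      rw [mul_zero, sub_zero] at this
      exact (this.eventually_const_lt hT).mono fun _ h => h.le
    filter_upwards [hev] with h hh
    rw [bifractionalCov_self hK.1 hH hh]
    ring

end Bifractional

theorem incrementVar_sum {ι : Type*} (s : Finset ι) (w : ι → ℝ) (R : ι → ℝ → ℝ → ℝ) (x y : ℝ) :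
    incrementVar (fun x y => ∑ i ∈ s, w i * R i x y) x y = ∑ i ∈ s, w i * incrementVar
        (R i) x y := by
  simp only [incrementVar, mul_sub, mul_add, Finset.sum_sub_distrib, Finset.sum_add_distrib,
    Finset.mul_sum]
  congr 1
  exact Finset.sum_congr rfl fun _ _ => by ring

theorem IsLocallyBrownian.sum {ι : Type*} {s : Finset ι} (hs : s.Nonempty) {w : ι → ℝ}
    (hw : ∀ i, 0 < w i) {R : ι → ℝ → ℝ → ℝ} {T : ℝ} {V C d D : ι → ℝ}
    (h : ∀ i, IsLocallyBrownian (R i) T (V i) (C i) (d i) (D i)) :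
    IsLocallyBrownian (fun x y => ∑ i ∈ s, w i * R i x y) T (∑ i ∈ s, w i * V i)
      (∑ i ∈ s, w i * C i) (∑ i ∈ s, w i * d i) (∑ i ∈ s, w i * D i) where
  pos_T := (h hs.choose).pos_T
  pos_V := Finset.sum_pos (fun i _ => mul_pos (hw i) (h i).pos_V) hs
  nonneg_C := Finset.sum_nonneg fun i _ => mul_nonneg (hw i).le (h i).nonneg_C
  var_end := Finset.sum_congr rfl fun i _ => by rw [(h i).var_end]
  var_le t ht := by
    rw [Finset.sum_mul]
    refine Finset.sum_le_sum fun i _ => ?_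
    rw [mul_assoc]
    exact mul_le_mul_of_nonneg_left ((h i).var_le t ht) (hw i).le
  incr_le x hx y hy := by
    rw [incrementVar_sum, Finset.sum_mul]
    refine Finset.sum_le_sum fun i _ => ?_
    rw [mul_assoc]
    exact mul_le_mul_of_nonneg_left ((h i).incr_le x hx y hy) (hw i).le
  var_sub_le x hx y hy := by
    rw [← Finset.sum_sub_distrib, Finset.sum_mul]
    refine (Finset.abs_sum_le_sum_abs _ _).trans (Finset.sum_le_sum fun i _ => ?_)
    rw [mul_assoc, ← mul_sub, abs_mul, abs_of_pos (hw i)]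
    exact mul_le_mul_of_nonneg_left ((h i).var_sub_le x hx y hy) (hw i).le
  tendsto_incr x y hx hy := by
    simp only [incrementVar_sum, Finset.sum_div, Finset.sum_mul, mul_div_assoc, mul_assoc]
    exact tendsto_finsetSum _ fun i _ => ((h i).tendsto_incr x y hx hy).const_mul (w i)
  tendsto_var x hx := by
    simp only [← Finset.sum_sub_distrib, ← mul_sub, Finset.sum_div, Finset.mul_sum, Finset.sum_mul,
      mul_div_assoc]
    refine tendsto_finsetSum _ fun i _ => ?_
    have := ((h i).tendsto_var x hx).const_mul (w i)
    rwa [show w i * (2 * d i * x) = 2 * (w i * d i) * x by ring] at this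

/-! ### Weighted sums of independent Gaussian processes -/

section Sums

variable {Ω : Type*} [MeasurableSpace Ω] {P : Measure Ω} {T : ℝ}

theorem integral_sq_of_map_eq_gaussianReal {Y : Ω → ℝ} (hY : Measurable Y) {v : ℝ≥0}
    (h : P.map Y = gaussianReal 0 v) : ∫ ω, Y ω ^ 2 ∂P = v := by
  have h1 := variance_fun_id_gaussianReal (μ := 0) (v := v)
  rw [variance_eq_integral measurable_id'.aemeasurable] at h1
  simp only [integral_id_gaussianReal, sub_zero] at h1
  rw [← h, integral_map hY.aemeasurable (by fun_prop)] at h1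
  exact h1

theorem memLp_two_of_map_eq_gaussianReal {Y : Ω → ℝ} (hY : Measurable Y) {v : ℝ≥0}
    (h : P.map Y = gaussianReal 0 v) : MemLp Y 2 P := by
  have h1 := memLp_id_gaussianReal' (μ := 0) (v := v) 2 (by simp)
  rw [← h] at h1
  exact (memLp_map_measure_iff aestronglyMeasurable_id hY.aemeasurable).1 h1

theorem IsCenteredGaussianProcess.isGaussianWithCov {X : ℝ → Ω → ℝ}
    (h : IsCenteredGaussianProcess P T X) {R : ℝ → ℝ → ℝ} (hsymm : ∀ s t, R s t = R t s)
    (hcov : ∀ s ∈ Icc 0 T, ∀ t ∈ Icc 0 T, ∫ ω, X s ω * X t ω ∂P = R s t) :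
    IsGaussianWithCov P T X R where
  symm := hsymm
  measurable := h.1
  law k c t ht := by
    have hmem : ∀ j, MemLp (X (t j)) 2 P := fun j => by
      obtain ⟨v, hv⟩ := h.2 1 (fun _ => 1) (fun _ => t j) fun _ => ht j
      simp only [Finset.univ_unique, one_mul, Finset.sum_const, Finset.card_singleton,
        one_smul] at hv
      exact memLp_two_of_map_eq_gaussianReal (h.1 _ (ht j)) hv
    obtain ⟨v, hv⟩ := h.2 k c t ht
    have hm : Measurable fun ω => ∑ j, c j * X (t j) ω :=
      Finset.measurable_sum _ fun j _ => (h.1 _ (ht j)).const_mul _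
    have h1 := integral_sq_of_map_eq_gaussianReal hm hv
    have h2 : ∀ i j, Integrable (fun ω => c i * c j * (X (t i) ω * X (t j) ω)) P := fun i j =>
      ((hmem i).integrable_mul (hmem j)).const_mul _
    have h3 : ∫ ω, (∑ j, c j * X (t j) ω) ^ 2 ∂P = ∑ i, ∑ j, c i * c j * R (t i) (t j) := by
      have e : ∀ ω, (∑ j, c j * X (t j) ω) ^ 2 =
          ∑ i, ∑ j, c i * c j * (X (t i) ω * X (t j) ω) := fun ω => by
        rw [sq, Finset.sum_mul_sum]
        exact Finset.sum_congr rfl fun i _ => Finset.sum_congr rfl fun j _ => by ring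
      simp only [e]
      rw [integral_finsetSum _ fun i _ => integrable_finsetSum _ fun j _ => h2 i j]
      refine Finset.sum_congr rfl fun i _ => ?_
      rw [integral_finsetSum _ fun j _ => h2 i j]
      refine Finset.sum_congr rfl fun j _ => ?_
      rw [integral_const_mul, hcov _ (ht i) _ (ht j)]
    rw [← h3, h1]
    exact ⟨v.coe_nonneg, by rw [hv, Real.toNNReal_coe]⟩

theorem IsCenteredGaussian.sum {ι : Type*} [Fintype ι] [IsProbabilityMeasure P] {Y : ι → Ω → ℝ}
    {s : ι → ℝ} (h : ∀ i, IsCenteredGaussian P (Y i) (s i)) (hindep : iIndepFun Y P) :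
    IsCenteredGaussian P (fun ω => ∑ i, Y i ω) (∑ i, s i) := by
  refine ⟨Finset.sum_nonneg fun i _ => (h i).1, ?_⟩
  have hm : AEMeasurable (∑ i, Y i) P := Finset.aemeasurable_sum _ fun i _ => (h i).aemeasurable
  have := Measure.isProbabilityMeasure_map hm
  have hsum : (fun ω => ∑ i, Y i ω) = ∑ i, Y i := by ext ω; simp
  rw [hsum]
  refine Measure.ext_of_charFun ?_
  rw [hindep.charFun_map_sum_eq_prod fun i => (h i).aemeasurable]
  ext t
  simp only [Finset.prod_apply, (h _).2, charFun_gaussianReal]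
  rw [← Complex.exp_sum]
  congr 1
  rw [Real.coe_toNNReal _ (Finset.sum_nonneg fun i _ => (h i).1)]
  simp only [Real.coe_toNNReal _ (h _).1]
  push_cast
  rw [Finset.sum_mul, Finset.sum_div]
  simp

theorem IsCenteredGaussian.const_mul {Y : Ω → ℝ} {s : ℝ} (h : IsCenteredGaussian P Y s) (a : ℝ) :
    IsCenteredGaussian P (fun ω => a * Y ω) (a ^ 2 * s) := by
  refine ⟨mul_nonneg (sq_nonneg a) h.1, ?_⟩
  have h1 := gaussianReal_map_const_mul (μ := 0) (v := s.toNNReal) a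
  rw [← h.2, AEMeasurable.map_map_of_aemeasurable (by fun_prop) h.aemeasurable, mul_zero] at h1
  refine h1.trans ?_
  congr 1
  ext
  rw [Real.coe_toNNReal _ (mul_nonneg (sq_nonneg a) h.1), NNReal.coe_mul,
    Real.coe_toNNReal _ h.1]
  rfl

theorem IsGaussianWithCov.sum {ι : Type*} [Fintype ι] [IsProbabilityMeasure P]
    {X : ι → ℝ → Ω → ℝ} {R : ι → ℝ → ℝ → ℝ} (h : ∀ i, IsGaussianWithCov P T (X i) (R i))
    (hindep : iIndep
      (fun i => ⨆ t : Icc (0:ℝ) T, MeasurableSpace.comap (X i t) inferInstance) P) (w : ι → ℝ) :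
    IsGaussianWithCov P T (fun t ω => ∑ i, w i * X i t ω)
      (fun s t => ∑ i, w i ^ 2 * R i s t) where
  symm s t := Finset.sum_congr rfl fun i _ => by rw [(h i).symm]
  measurable t ht := Finset.measurable_sum _ fun i _ => ((h i).measurable t ht).const_mul _
  law k c t ht := by
    have hY : iIndepFun (fun i ω => w i * ∑ j, c j * X i (t j) ω) P := by
      rw [iIndepFun_iff]
      intro s f hf
      refine (iIndep_iff _ _).1 hindep s fun i hi => ?_
      obtain ⟨B, hB, hfB⟩ := hf i hi
      rw [← hfB]
      have hX : ∀ j, Measurable[⨆ t : Icc (0:ℝ) T, MeasurableSpace.comap (X i t) inferInstance]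
          (X i (t j)) := fun j =>
        Measurable.mono (comap_measurable (X i (t j)))
          (le_iSup (fun t : Icc (0:ℝ) T => MeasurableSpace.comap (X i t) inferInstance) ⟨t j, ht j⟩)
          le_rfl
      have hm : Measurable[⨆ t : Icc (0:ℝ) T, MeasurableSpace.comap (X i t) inferInstance]
          (fun ω => w i * ∑ j, c j * X i (t j) ω) :=
        (Finset.measurable_sum _ fun j _ => (hX j).const_mul _).const_mul _
      exact hm hB
    have h1 := IsCenteredGaussian.sum (fun i => ((h i).law k c t ht).const_mul (w i)) hY
    convert h1 using 1
    · ext ω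
      simp only [Finset.mul_sum]
      rw [Finset.sum_comm]
      exact Finset.sum_congr rfl fun _ _ => Finset.sum_congr rfl fun _ _ => by ring
    · simp only [Finset.mul_sum]
      refine (Finset.sum_congr rfl fun a _ => Finset.sum_comm).trans ?_
      rw [Finset.sum_comm]
      exact Finset.sum_congr rfl fun _ _ => Finset.sum_congr rfl fun _ _ =>
        Finset.sum_congr rfl fun _ _ => by ring

end Sums

/-! ### Ruin probability -/

theorem exists_forall_abs_sub_le {T ν M B : ℝ} (hν : ν < T) {g : ℝ → ℝ}
    (hB : ∀ t ∈ Icc 0 T, |g t| ≤ B) (hg : ∀ t ∈ Icc ν T, |g T - g t| ≤ M * (T - t)) :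
    ∃ M', ∀ t ∈ Icc 0 T, |g T - g t| ≤ M' * (T - t) := by
  refine ⟨max M (2 * B / (T - ν)), fun t ht => ?_⟩
  have htT := sub_nonneg.2 ht.2
  rcases le_total ν t with h | h
  · exact (hg t ⟨h, ht.2⟩).trans (mul_le_mul_of_nonneg_right (le_max_left _ _) htT)
  · refine le_trans ?_ (mul_le_mul_of_nonneg_right (le_max_right _ _) htT)
    have hpos := sub_pos.2 hν
    have h1 := abs_sub (g T) (g t)
    have h2 := hB T ⟨ht.1.trans ht.2, le_rfl⟩
    have h3 := hB t ht
    have hB0 : 0 ≤ B := (abs_nonneg _).trans h3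
    rw [div_mul_eq_mul_div, le_div_iff₀ hpos]
    nlinarith

theorem lt_iSup_sub_iff {T : ℝ} (hT : 0 ≤ T) {f g : ℝ → ℝ} (hf : ContinuousOn f (Icc 0 T))
    {B : ℝ} (hB : ∀ t ∈ Icc 0 T, |g t| ≤ B) (u : ℝ) :
    u < (⨆ t : Icc (0:ℝ) T, (f t - g t)) ↔ ∃ t ∈ Icc 0 T, u + g T < f t + (g T - g t) := by
  obtain ⟨A, hA⟩ := (isCompact_Icc.image_of_continuousOn hf).bddAbove
  have hbdd : BddAbove (range fun t : Icc (0:ℝ) T => f t - g t) := by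
    refine ⟨A + B, ?_⟩
    rintro _ ⟨t, rfl⟩
    have h1 := hA (mem_image_of_mem f t.2)
    have h2 := (abs_le.1 (hB t t.2)).1
    simp only
    linarith
  have : Nonempty (Icc (0:ℝ) T) := ⟨⟨0, le_rfl, hT⟩⟩
  rw [lt_ciSup_iff hbdd, Subtype.exists]
  refine exists_congr fun t => ⟨?_, ?_⟩ <;> rintro ⟨ht, h⟩ <;> exact ⟨ht, by linarith⟩

theorem stdNormalTail_div_sqrt {V : ℝ} (hV : 0 < V) (x : ℝ) :
    stdNormalTail (x / Real.sqrt V) = (gaussianReal 0 V.toNNReal (Ioi x)).toReal := by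
  have hs := Real.sqrt_pos.2 hV
  have h1 := gaussianReal_map_const_mul (μ := 0) (v := 1) (Real.sqrt V)
  have h2 : NNReal.mk (Real.sqrt V ^ 2) (sq_nonneg _) * 1 = V.toNNReal := by
    ext
    rw [mul_one, Real.coe_toNNReal _ hV.le]
    exact Real.sq_sqrt hV.le
  unfold stdNormalTail
  rw [mul_zero, h2] at h1
  rw [← h1, Measure.map_apply (by fun_prop) measurableSet_Ioi]
  congr 2
  ext y
  simp only [mem_Ioi, mem_preimage]
  rw [div_lt_iff₀ hs, mul_comm]

/-- Ruin probability of a locally Brownian Gaussian process with a bounded drift. -/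
theorem IsGaussianWithCov.tendsto_ruin {Ω : Type*} [MeasurableSpace Ω] {P : Measure Ω}
    [IsProbabilityMeasure P] {T V C d D : ℝ} {Z : ℝ → Ω → ℝ} {R : ℝ → ℝ → ℝ}
    (h : IsGaussianWithCov P T Z R) (hR : IsLocallyBrownian R T V C d D) (hD : 0 < D) (hd : 0 < d)
    (hcont : ∀ᵐ ω ∂P, ContinuousOn (fun t => Z t ω) (Icc 0 T)) {g : ℝ → ℝ} {M B ν : ℝ}
    (hB : ∀ t ∈ Icc 0 T, |g t| ≤ B) (hν : ν < T)
    (hg : ∀ t ∈ Icc ν T, |g T - g t| ≤ M * (T - t)) :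
    Tendsto (fun u => (P {ω | u < ⨆ t : Icc (0:ℝ) T, (Z t ω - g t)}).toReal /
      stdNormalTail ((u + g T) / Real.sqrt V)) atTop (nhds (1 + D / (2 * d))) := by
  have hV := hR.pos_V
  obtain ⟨M', hM'⟩ := exists_forall_abs_sub_le hν hB hg
  refine tendsto_of_seq_tendsto fun u hu => ?_
  have hv : Tendsto (fun n => u n + g T) atTop atTop := tendsto_atTop_add_const_right _ _ hu
  have h1 := (ENNReal.tendsto_toReal ENNReal.ofReal_ne_top).comp
    (h.tendsto_measure_exists hR hD hd hcont hM' hv)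
  have h2 := (ENNReal.tendsto_toReal ENNReal.one_ne_top).comp
    (tendsto_gaussianReal_Ioi_div_tailNorm hV hv)
  have h3 := h1.div h2 (by simp)
  rw [ENNReal.toReal_ofReal (by positivity), ENNReal.toReal_one, div_one] at h3
  refine h3.congr' ?_
  filter_upwards [hv.eventually_gt_atTop 0] with n hn
  have htn := tailNorm_pos hV hn
  have hset : P {ω | u n < ⨆ t : Icc (0:ℝ) T, (Z t ω - g t)} =
      P {ω | ∃ t ∈ Icc 0 T, u n + g T < Z t ω + (g T - g t)} := by
    refine measure_congr ?_
    filter_upwards [hcont] with ω hω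
    exact propext (lt_iSup_sub_iff hR.pos_T.le hω hB (u n))
  simp only [Pi.div_apply, Function.comp_apply, ENNReal.toReal_div]
  rw [hset, stdNormalTail_div_sqrt hV, div_div_div_cancel_right₀]
  rw [ENNReal.toReal_ofReal htn.le]
  exact htn.ne'

end

/-- exact asymptotics of the finite-time ruin probability for a weighted
sum of independent bifractional Brownian motions in the boundary case `K₁H₁ = 1/2`,
`1/2 < K₂H₂ ≤ ⋯ ≤ K_nH_n` (Corollary 3.2 (i) of the paper, case `KH = 1/2`). -/
theorem stmt18 {Ω : Type*} [MeasurableSpace Ω] (P : Measure Ω) [IsProbabilityMeasure P]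
    (T : ℝ) (hT : 0 < T) (n : ℕ) [NeZero n]
    (X : Fin n → ℝ → Ω → ℝ) (K H : Fin n → ℝ)
    (hK : ∀ i, K i ∈ Set.Ioc (0:ℝ) 1) (hH : ∀ i, H i ∈ Set.Ioo (0:ℝ) 1)
    (hKH0 : K 0 * H 0 = 1 / 2)
    (hKH_rest : ∀ i : Fin n, i ≠ 0 → 1 / 2 < K i * H i)
    (hKH_mono : ∀ i j : Fin n, i ≠ 0 → i ≤ j → K i * H i ≤ K j * H j)
    (hGauss : ∀ i, IsCenteredGaussianProcess P T (X i))
    (hindep : iIndep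
      (fun i => ⨆ t : Set.Icc (0:ℝ) T, MeasurableSpace.comap (X i t) inferInstance) P)
    (hcont : ∀ i, ∀ᵐ ω ∂P, ContinuousOn (fun t => X i t ω) (Set.Icc (0:ℝ) T))
    (hcov : ∀ i, ∀ s ∈ Set.Icc (0:ℝ) T, ∀ t ∈ Set.Icc (0:ℝ) T,
      ∫ ω, X i s ω * X i t ω ∂P =
        (2:ℝ) ^ (-(K i)) * ((t ^ (2 * H i) + s ^ (2 * H i)) ^ K i -
          |t - s| ^ (2 * K i * H i)))
    (lam : Fin n → ℝ) (hlam : ∀ i, 0 < lam i)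
    (g : ℝ → ℝ) (hg_meas : Measurable g)
    (hg_bdd : ∃ B : ℝ, ∀ t ∈ Set.Icc (0:ℝ) T, |g t| ≤ B)
    (M ν : ℝ) (hν : ν ∈ Set.Ioo 0 T)
    (hg : ∀ t ∈ Set.Icc ν T, |g T - g t| ≤ M * (T - t)) :
    Tendsto (fun u =>
        (P {ω | u < ⨆ t : Set.Icc (0:ℝ) T, (∑ i, lam i * X i t ω - g t)}).toReal /
          stdNormalTail ((u + g T) / Real.sqrt (∑ i, lam i ^ 2 * T ^ (2 * K i * H i))))
      atTop
      (nhds (1 + lam 0 ^ 2 * T /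
        ((2:ℝ) ^ K 0 *
          ((∑ i ∈ Finset.univ.filter fun i => i ≠ 0,
              lam i ^ 2 * K i * H i * T ^ (2 * K i * H i)) + lam 0 ^ 2 * T / 2)))) := by
  obtain ⟨B, hB⟩ := hg_bdd
  have hKH : ∀ i, 1 / 2 ≤ K i * H i := fun i => by
    by_cases hi : i = 0
    · rw [hi, hKH0]
    · exact (hKH_rest i hi).le
  have hZ := IsGaussianWithCov.sum
    (fun i => (hGauss i).isGaussianWithCov (bifractionalCov_symm (K i) (H i)) (hcov i)) hindep lam
  have hR := IsLocallyBrownian.sum (s := Finset.univ) Finset.univ_nonempty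
    (w := fun i => lam i ^ 2) (fun i => pow_pos (hlam i) 2)
    fun i => isLocallyBrownian_bifractionalCov (hK i) (hH i).1 (hKH i) hT
  have hc : ∀ᵐ ω ∂P, ContinuousOn (fun t => ∑ i, lam i * X i t ω) (Icc 0 T) := by
    filter_upwards [ae_all_iff.2 hcont] with ω hω
    exact continuousOn_finsetSum _ fun i _ => continuousOn_const.mul (hω i)
  have hD : ∑ i, lam i ^ 2 * bifractionalRate (K i) (H i) = lam 0 ^ 2 * (2 : ℝ) ^ (1 - K 0) := by
    rw [Finset.sum_eq_single 0]
    · rw [bifractionalRate, if_pos hKH0]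
    · intro i _ hi
      rw [bifractionalRate, if_neg (hKH_rest i hi).ne', mul_zero]
    · simp
  have hd : ∑ i, lam i ^ 2 * (K i * H i * T ^ (2 * K i * H i) / T) =
      ((∑ i ∈ Finset.univ.filter fun i => i ≠ 0,
        lam i ^ 2 * K i * H i * T ^ (2 * K i * H i)) + lam 0 ^ 2 * T / 2) / T := by
    rw [Finset.filter_ne', ← Finset.add_sum_erase _ _ (Finset.mem_univ (0 : Fin n)), add_div,
      Finset.sum_div, add_comm]
    congr 1
    · exact Finset.sum_congr rfl fun i _ => by ring
    · rw [show 2 * K 0 * H 0 = 1 by linarith, hKH0, Real.rpow_one]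
      ring
  have hD0 : 0 < lam 0 ^ 2 * (2 : ℝ) ^ (1 - K 0) :=
    mul_pos (pow_pos (hlam 0) 2) (Real.rpow_pos_of_pos two_pos _)
  have hd0 : 0 < ∑ i, lam i ^ 2 * (K i * H i * T ^ (2 * K i * H i) / T) :=
    Finset.sum_pos (fun i _ => mul_pos (pow_pos (hlam i) 2) (div_pos (mul_pos
      (by linarith [hKH i]) (Real.rpow_pos_of_pos hT _)) hT)) Finset.univ_nonempty
  have h := hZ.tendsto_ruin hR (hD ▸ hD0) hd0 hc hB hν.2 hg
  convert h using 3
  rw [hd] at hd0 ⊢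
  rw [hD, Real.rpow_sub two_pos, Real.rpow_one]
  have := Real.rpow_pos_of_pos two_pos (K 0)
  have hne := (div_pos_iff_of_pos_right hT).1 hd0
  set S := (∑ i ∈ Finset.univ.filter fun i => i ≠ 0,
        lam i ^ 2 * K i * H i * T ^ (2 * K i * H i)) + lam 0 ^ 2 * T / 2
  field_simp
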